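/- arXiv:1804.00391 — 9 statements merged into one kernel-verified Lean document; each statement's English description precedes it below -/
import Mathlib

section
/- For every defender mixed strategy σd with induced security effort vector ρ and every attacker mixed strategy σa, the expected utilities satisfy Ud(σd,σa) = −∑_{e∈E}[ρ_e·((C0−C_e)·σa(e)+pd) + C_e·σa(e)] − C0·σa(∅) and Ua(σd,σa) = ∑_{e∈E}[ρ_e·(C0−C_e)·σa(e) + C_e·σa(e)] + C0·σa(∅) − pa·∑_{e∈E}σa(e). In particular, any two defender mixed strategies inducing the same effort vector yield identical expected utilities for both players against every attacker mixed strategy. -/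
open Finset

noncomputable section

namespace SecGame

variable {E : Type*} [Fintype E] [DecidableEq E]

/-- Usage cost after the attacker–defender interaction. -/
def usageCost (C0 : ℝ) (Ce : E → ℝ) (sd : Finset E) : Option E → ℝ
  | some e => if e ∈ sd then C0 else Ce e
  | none => C0

/-- Defender mixed strategy over subsets of facilities. -/
def IsDefMixed (σd : Finset E → ℝ) : Prop :=
  (∀ sd, 0 ≤ σd sd) ∧ ∑ sd : Finset E, σd sd = 1

/-- Attacker mixed strategy over `E ∪ {∅}`. -/
def IsAtkMixed (σa : Option E → ℝ) : Prop :=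
  (∀ sa, 0 ≤ σa sa) ∧ ∑ sa : Option E, σa sa = 1

/-- Defender expected utility. -/
def Ud (C0 : ℝ) (Ce : E → ℝ) (pd : ℝ) (σd : Finset E → ℝ) (σa : Option E → ℝ) : ℝ :=
  ∑ sd : Finset E, ∑ sa : Option E,
    σd sd * σa sa * (-(usageCost C0 Ce sd sa) - pd * (sd.card : ℝ))

/-- Attacker expected utility. -/
def Ua (C0 : ℝ) (Ce : E → ℝ) (pa : ℝ) (σd : Finset E → ℝ) (σa : Option E → ℝ) : ℝ :=
  ∑ sd : Finset E, ∑ sa : Option E,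
    σd sd * σa sa * (usageCost C0 Ce sd sa - pa * (if sa = none then 0 else 1))

/-- Security effort vector induced by a defender mixed strategy. -/
def effort (σd : Finset E → ℝ) (e : E) : ℝ :=
  ∑ sd ∈ Finset.univ.filter (fun sd => e ∈ sd), σd sd

/-- Nash equilibrium of the normal form game Γ. -/
def IsNE (C0 : ℝ) (Ce : E → ℝ) (pa pd : ℝ) (σd : Finset E → ℝ) (σa : Option E → ℝ) : Prop :=
  IsDefMixed σd ∧ IsAtkMixed σa ∧
  (∀ σd', IsDefMixed σd' → Ud C0 Ce pd σd' σa ≤ Ud C0 Ce pd σd σa) ∧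
  (∀ σa', IsAtkMixed σa' → Ua C0 Ce pa σd σa' ≤ Ua C0 Ce pa σd σa)

/-- Security effort vectors in the unit box `[0,1]^E`. -/
def InBox (ρ : E → ℝ) : Prop := ∀ e, 0 ≤ ρ e ∧ ρ e ≤ 1

/-- Defender expected utility as a function of the security effort vector. -/
def UdRho (C0 : ℝ) (Ce : E → ℝ) (pd : ℝ) (ρ : E → ℝ) (σa : Option E → ℝ) : ℝ :=
  -(∑ e : E, (ρ e * ((C0 - Ce e) * σa (some e) + pd) + Ce e * σa (some e))) - C0 * σa none

/-- Attacker expected utility as a function of the security effort vector. -/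
def UaRho (C0 : ℝ) (Ce : E → ℝ) (pa : ℝ) (ρ : E → ℝ) (σa : Option E → ℝ) : ℝ :=
  (∑ e : E, (ρ e * (C0 - Ce e) * σa (some e) + Ce e * σa (some e))) + C0 * σa none
    - pa * ∑ e : E, σa (some e)

/-- Threshold security effort for a vulnerable facility. -/
def rhoHat (C0 : ℝ) (Ce : E → ℝ) (pa : ℝ) (e : E) : ℝ := (Ce e - pa - C0) / (Ce e - C0)

/-- Subgame perfect equilibrium of the sequential game Γ̃. -/
def IsSPE (C0 : ℝ) (Ce : E → ℝ) (pa pd : ℝ) (ρstar : E → ℝ)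
    (σastar : (E → ℝ) → Option E → ℝ) : Prop :=
  InBox ρstar ∧
  (∀ ρ, InBox ρ → IsAtkMixed (σastar ρ) ∧
    ∀ σa, IsAtkMixed σa → UaRho C0 Ce pa ρ σa ≤ UaRho C0 Ce pa ρ (σastar ρ)) ∧
  (∀ ρ, InBox ρ → UdRho C0 Ce pd ρ (σastar ρ) ≤ UdRho C0 Ce pd ρstar (σastar ρstar))

theorem effort_eq_sum_ite (σd : Finset E → ℝ) (e : E) :
    effort σd e = ∑ sd : Finset E, if e ∈ sd then σd sd else 0 :=
  Finset.sum_filter _ _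

theorem sum_mul_card_eq_sum_effort (σd : Finset E → ℝ) :
    ∑ sd : Finset E, σd sd * (sd.card : ℝ) = ∑ e : E, effort σd e := by
  simp_rw [effort_eq_sum_ite]
  rw [Finset.sum_comm]
  refine Finset.sum_congr rfl fun sd _ => ?_
  simp [mul_comm]

theorem IsDefMixed.sum_mul_usageCost_none {σd : Finset E → ℝ} (hσd : IsDefMixed σd)
    (C0 : ℝ) (Ce : E → ℝ) :
    ∑ sd : Finset E, σd sd * usageCost C0 Ce sd none = C0 := by
  simp only [usageCost, ← Finset.sum_mul, hσd.2, one_mul]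

theorem IsDefMixed.sum_mul_usageCost_some {σd : Finset E → ℝ} (hσd : IsDefMixed σd)
    (C0 : ℝ) (Ce : E → ℝ) (e : E) :
    ∑ sd : Finset E, σd sd * usageCost C0 Ce sd (some e) =
      effort σd e * (C0 - Ce e) + Ce e := by
  have h : ∀ sd : Finset E, σd sd * usageCost C0 Ce sd (some e) =
      (if e ∈ sd then σd sd else 0) * (C0 - Ce e) + σd sd * Ce e := by
    intro sd
    simp only [usageCost]
    split_ifs <;> ring
  simp_rw [h, Finset.sum_add_distrib, ← Finset.sum_mul, hσd.2, ← effort_eq_sum_ite, one_mul]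

/-- The expected usage cost depends on the defender strategy only through the effort vector. -/
theorem IsDefMixed.expected_usageCost {σd : Finset E → ℝ} (hσd : IsDefMixed σd)
    (C0 : ℝ) (Ce : E → ℝ) (σa : Option E → ℝ) :
    ∑ sd : Finset E, ∑ sa : Option E, σd sd * σa sa * usageCost C0 Ce sd sa =
      ∑ e : E, (effort σd e * (C0 - Ce e) * σa (some e) + Ce e * σa (some e)) +
        C0 * σa none := by
  have h : ∀ sa : Option E, ∑ sd : Finset E, σd sd * σa sa * usageCost C0 Ce sd sa =
      (∑ sd : Finset E, σd sd * usageCost C0 Ce sd sa) * σa sa := by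
    intro sa
    rw [Finset.sum_mul]
    exact Finset.sum_congr rfl fun sd _ => by ring
  rw [Finset.sum_comm]
  simp_rw [h, Fintype.sum_option, hσd.sum_mul_usageCost_none, hσd.sum_mul_usageCost_some,
    add_mul]
  ring

theorem Ud_eq_UdRho (C0 : ℝ) (Ce : E → ℝ) (pd : ℝ) {σd : Finset E → ℝ} (hσd : IsDefMixed σd)
    {σa : Option E → ℝ} (hσa : IsAtkMixed σa) :
    Ud C0 Ce pd σd σa = UdRho C0 Ce pd (effort σd) σa := by
  have hcard : ∑ sd : Finset E, ∑ sa : Option E, σd sd * σa sa * (pd * (sd.card : ℝ)) =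
      pd * ∑ e : E, effort σd e := by
    rw [← sum_mul_card_eq_sum_effort, Finset.mul_sum]
    refine Finset.sum_congr rfl fun sd _ => ?_
    rw [← Finset.sum_mul, ← Finset.mul_sum, hσa.2]
    ring
  have hsum : ∑ e : E, (effort σd e * ((C0 - Ce e) * σa (some e) + pd) + Ce e * σa (some e)) =
      ∑ e : E, (effort σd e * (C0 - Ce e) * σa (some e) + Ce e * σa (some e)) +
        pd * ∑ e : E, effort σd e := by
    rw [Finset.mul_sum, ← Finset.sum_add_distrib]
    exact Finset.sum_congr rfl fun e _ => by ring
  have hcost := hσd.expected_usageCost C0 Ce σa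
  simp only [Ud, UdRho, mul_sub, mul_neg, Finset.sum_sub_distrib, Finset.sum_neg_distrib] at *
  linarith

theorem Ua_eq_UaRho (C0 : ℝ) (Ce : E → ℝ) (pa : ℝ) {σd : Finset E → ℝ} (hσd : IsDefMixed σd)
    (σa : Option E → ℝ) :
    Ua C0 Ce pa σd σa = UaRho C0 Ce pa (effort σd) σa := by
  have hattack : ∑ sd : Finset E, ∑ sa : Option E,
      σd sd * σa sa * (pa * (if sa = none then 0 else 1)) = pa * ∑ e : E, σa (some e) := by
    simp_rw [mul_assoc, ← Finset.mul_sum, ← Finset.sum_mul, hσd.2, one_mul]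
    simp [Fintype.sum_option, Finset.mul_sum, mul_comm]
  unfold Ua UaRho
  simp_rw [mul_sub (_ * _), Finset.sum_sub_distrib]
  rw [hattack, hσd.expected_usageCost]

/-- **Utilities depend on the defender strategy only through the security effort vector.**
For every defender mixed strategy `σd` with induced effort vector `ρ = effort σd` and every
attacker mixed strategy `σa`,
`Ud(σd,σa) = −∑_e [ρ_e((C0−C_e)σa(e)+pd) + C_e σa(e)] − C0 σa(∅)` and
`Ua(σd,σa) = ∑_e [ρ_e(C0−C_e)σa(e) + C_e σa(e)] + C0 σa(∅) − pa ∑_e σa(e)`.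
In particular any two defender strategies with the same induced effort vector yield
identical expected utilities for both players against every attacker strategy. -/
theorem utilities_through_effort {E : Type*} [Fintype E] [DecidableEq E] [Nonempty E]
    (C0 : ℝ) (Ce : E → ℝ) (pa pd : ℝ) (hpa : 0 < pa) (hpd : 0 < pd)
    (σd : Finset E → ℝ) (hσd : IsDefMixed σd)
    (σa : Option E → ℝ) (hσa : IsAtkMixed σa) :
    Ud C0 Ce pd σd σa = UdRho C0 Ce pd (effort σd) σa ∧
    Ua C0 Ce pa σd σa = UaRho C0 Ce pa (effort σd) σa ∧
    (∀ σd' : Finset E → ℝ, IsDefMixed σd' → (∀ e : E, effort σd' e = effort σd e) →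
      Ud C0 Ce pd σd' σa = Ud C0 Ce pd σd σa ∧
      Ua C0 Ce pa σd' σa = Ua C0 Ce pa σd σa) := by
  refine ⟨Ud_eq_UdRho C0 Ce pd hσd hσa, Ua_eq_UaRho C0 Ce pa hσd σa, fun σd' hσd' h => ?_⟩
  rw [Ud_eq_UdRho C0 Ce pd hσd' hσa, Ud_eq_UdRho C0 Ce pd hσd hσa,
    Ua_eq_UaRho C0 Ce pa hσd' σa, Ua_eq_UaRho C0 Ce pa hσd σa, funext h]
  exact ⟨rfl, rfl⟩

end SecGame
end
end

section
/- In every Nash equilibrium (σd*, σa*) of the normal-form game Γ, for every facility e ∈ E with C_e ≤ C0 one has ρ*_e = 0 and σa*(e) = 0, where ρ* is the security effort vector induced by σd*. -/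
open Finset

noncomputable section

namespace SecGame

variable {E : Type*} [Fintype E] [DecidableEq E]

/-- A pure strategy with strictly smaller payoff than another one has probability zero in every
mixed strategy maximizing the expected payoff. -/
theorem eq_zero_of_maximizes_of_payoff_lt {α : Type*} [Fintype α] [DecidableEq α]
    {σ f : α → ℝ} (hσ : (∀ x, 0 ≤ σ x) ∧ ∑ x, σ x = 1)
    (hmax : ∀ τ : α → ℝ, ((∀ x, 0 ≤ τ x) ∧ ∑ x, τ x = 1) → ∑ x, τ x * f x ≤ ∑ x, σ x * f x)
    {a b : α} (hab : f b < f a) : σ b = 0 := by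
  have hne : a ≠ b := by
    rintro rfl
    exact lt_irrefl _ hab
  have h := hmax (fun x => σ x + σ b * ((if x = a then 1 else 0) - if x = b then 1 else 0))
    ⟨fun x => ?_, ?_⟩
  · simp only [add_mul, Finset.sum_add_distrib, mul_assoc, ← Finset.mul_sum, sub_mul, ite_mul,
      one_mul, zero_mul, Finset.sum_sub_distrib, Finset.sum_ite_eq', Finset.mem_univ,
      if_true] at h
    nlinarith [hσ.1 b]
  · have hx := hσ.1 x
    have hb := hσ.1 b
    split_ifs with h₁ h₂ h₂
    · exact absurd (h₁.symm.trans h₂) hne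
    · linarith
    · subst h₂
      linarith
    · linarith
  · simp [Finset.sum_add_distrib, ← Finset.mul_sum, hσ.2]

/-- In a best response, the attacker never targets a facility whose compromise does not increase
the usage cost. -/
theorem attack_prob_eq_zero {E : Type*} [Fintype E] [DecidableEq E]
    {C0 : ℝ} {Ce : E → ℝ} {pa : ℝ} (hpa : 0 < pa) {σd : Finset E → ℝ} {σa : Option E → ℝ}
    (hd : IsDefMixed σd) (ha : IsAtkMixed σa)
    (hopt : ∀ σa', IsAtkMixed σa' → Ua C0 Ce pa σd σa' ≤ Ua C0 Ce pa σd σa)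
    {e : E} (he : Ce e ≤ C0) : σa (some e) = 0 := by
  have hUa (τ : Option E → ℝ) : Ua C0 Ce pa σd τ = ∑ sa, τ sa *
      ∑ sd, σd sd * (usageCost C0 Ce sd sa - pa * (if sa = none then 0 else 1)) := by
    simp only [Ua, Finset.mul_sum]
    rw [Finset.sum_comm]
    exact Finset.sum_congr rfl fun _ _ => Finset.sum_congr rfl fun _ _ => by ring
  simp only [hUa] at hopt
  refine eq_zero_of_maximizes_of_payoff_lt ha hopt (a := none) ?_
  have hle : ∑ sd, σd sd * (usageCost C0 Ce sd (some e) - pa * (if some e = none then 0 else 1))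
      ≤ ∑ sd, σd sd * (C0 - pa) := by
    refine Finset.sum_le_sum fun sd _ => mul_le_mul_of_nonneg_left ?_ (hd.1 sd)
    simp only [usageCost, reduceCtorEq, if_false]
    split_ifs <;> linarith
  refine hle.trans_lt ?_
  simp only [usageCost, if_true, mul_zero, sub_zero, ← Finset.sum_mul, hd.2]
  linarith

/-- In a best response, the defender never secures a facility that is attacked with probability
zero. -/
theorem defense_prob_eq_zero {E : Type*} [Fintype E] [DecidableEq E]
    {C0 : ℝ} {Ce : E → ℝ} {pd : ℝ} (hpd : 0 < pd) {σd : Finset E → ℝ} {σa : Option E → ℝ}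
    (hd : IsDefMixed σd) (ha : IsAtkMixed σa)
    (hopt : ∀ σd', IsDefMixed σd' → Ud C0 Ce pd σd' σa ≤ Ud C0 Ce pd σd σa)
    {e : E} (he : σa (some e) = 0) {sd : Finset E} (hsd : e ∈ sd) : σd sd = 0 := by
  have hUd (τ : Finset E → ℝ) : Ud C0 Ce pd τ σa = ∑ s, τ s *
      ∑ sa, σa sa * (-(usageCost C0 Ce s sa) - pd * (s.card : ℝ)) := by
    simp only [Ud, Finset.mul_sum, mul_assoc]
  simp only [hUd] at hopt
  refine eq_zero_of_maximizes_of_payoff_lt hd hopt (a := sd.erase e) ?_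
  have hcard : (sd.card : ℝ) = (sd.erase e).card + 1 := by
    exact_mod_cast (Finset.card_erase_add_one hsd).symm
  have heq : ∑ sa, σa sa * (-(usageCost C0 Ce (sd.erase e) sa) - pd * ((sd.erase e).card : ℝ))
      = ∑ sa, (σa sa * (-(usageCost C0 Ce sd sa) - pd * (sd.card : ℝ)) + σa sa * pd) := by
    refine Finset.sum_congr rfl fun sa _ => ?_
    rw [hcard]
    rcases sa with _ | e'
    · simp only [usageCost]
      ring
    · by_cases h : e' = e
      · subst h
        simp [he]
      · simp only [usageCost, Finset.mem_erase, ne_eq, h, not_false_eq_true, true_and]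
        ring
  rw [heq, Finset.sum_add_distrib, ← Finset.sum_mul, ha.2]
  linarith

/-- **Proposition 1 (rationalizable strategies).**
In every Nash equilibrium `(σd*, σa*)` of the normal-form game Γ, for every facility
`e` with `C_e ≤ C0` (i.e. `e ∉ Ē`), the induced security effort on `e` is zero and
the attacker targets `e` with probability zero. -/
theorem NE_no_effort_no_attack_outside_Ebar {E : Type*} [Fintype E] [DecidableEq E] [Nonempty E]
    (C0 : ℝ) (Ce : E → ℝ) (pa pd : ℝ) (hpa : 0 < pa) (hpd : 0 < pd)
    (σd : Finset E → ℝ) (σa : Option E → ℝ)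
    (hNE : IsNE C0 Ce pa pd σd σa) :
    ∀ e : E, Ce e ≤ C0 → effort σd e = 0 ∧ σa (some e) = 0 := by
  obtain ⟨hd, ha, hdopt, haopt⟩ := hNE
  intro e he
  have hatk : σa (some e) = 0 := attack_prob_eq_zero hpa hd ha haopt he
  refine ⟨Finset.sum_eq_zero fun sd hsd => ?_, hatk⟩
  exact defense_prob_eq_zero hpd hd ha hdopt hatk (Finset.mem_filter.mp hsd).2

end SecGame
end
end

section
/- Define the zero-sum game Γ0 by Ua0(σd,σa) = Ua(σd,σa) + pd·∑_{sd⊆E}|sd|·σd(sd) and Ud0(σd,σa) = −Ua0(σd,σa). Then a profile (σd,σa) is a Nash equilibrium of the normal-form game Γ if and only if it is a Nash equilibrium of Γ0. Consequently, the equilibria of Γ are interchangeable: if (σd¹,σa¹) and (σd²,σa²) are Nash equilibria of Γ, then (σd¹,σa²) and (σd²,σa¹) are also Nash equilibria of Γ. -/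
open Finset

noncomputable section

namespace SecGame

variable {E : Type*} [Fintype E] [DecidableEq E]

/-- Attacker utility in the strategically equivalent zero-sum game Γ0:
`Ua0(σd,σa) = Ua(σd,σa) + pd·∑_{sd} |sd|·σd(sd)`. -/
def Ua0 (C0 : ℝ) (Ce : E → ℝ) (pa pd : ℝ) (σd : Finset E → ℝ) (σa : Option E → ℝ) : ℝ :=
  Ua C0 Ce pa σd σa + pd * ∑ sd : Finset E, (sd.card : ℝ) * σd sd

/-- Defender utility in the zero-sum game Γ0: `Ud0 = −Ua0`. -/
def Ud0 (C0 : ℝ) (Ce : E → ℝ) (pa pd : ℝ) (σd : Finset E → ℝ) (σa : Option E → ℝ) : ℝ :=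
  -(Ua0 C0 Ce pa pd σd σa)

/-- Nash equilibrium of the zero-sum game Γ0. -/
def IsNE0 (C0 : ℝ) (Ce : E → ℝ) (pa pd : ℝ) (σd : Finset E → ℝ) (σa : Option E → ℝ) : Prop :=
  IsDefMixed σd ∧ IsAtkMixed σa ∧
  (∀ σd', IsDefMixed σd' → Ud0 C0 Ce pa pd σd' σa ≤ Ud0 C0 Ce pa pd σd σa) ∧
  (∀ σa', IsAtkMixed σa' → Ua0 C0 Ce pa pd σd σa' ≤ Ua0 C0 Ce pa pd σd σa)

/-- Against mixed strategies, the defender's utilities in Γ0 and in Γ differ by the expected attack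
cost, which does not depend on the defender's strategy. -/
theorem Ud0_eq_Ud_add (C0 : ℝ) (Ce : E → ℝ) (pa pd : ℝ) {σd : Finset E → ℝ} {σa : Option E → ℝ}
    (hd : IsDefMixed σd) (ha : IsAtkMixed σa) :
    Ud0 C0 Ce pa pd σd σa =
      Ud C0 Ce pd σd σa + pa * ∑ sa : Option E, σa sa * (if sa = none then 0 else 1) := by
  have hcard : pd * ∑ sd : Finset E, (sd.card : ℝ) * σd sd =
      ∑ sd : Finset E, ∑ sa : Option E, σd sd * σa sa * (pd * (sd.card : ℝ)) := by
    rw [← mul_one (pd * _), ← ha.2, mul_assoc, Finset.sum_mul_sum, Finset.mul_sum]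
    refine Finset.sum_congr rfl fun sd _ => ?_
    rw [Finset.mul_sum]
    exact Finset.sum_congr rfl fun sa _ => by ring
  have hattack : pa * ∑ sa : Option E, σa sa * (if sa = none then (0 : ℝ) else 1) =
      ∑ sd : Finset E, ∑ sa : Option E,
        σd sd * σa sa * (pa * (if sa = none then 0 else 1)) := by
    rw [← one_mul (∑ sa : Option E, _), ← hd.2, Finset.sum_mul_sum, Finset.mul_sum]
    refine Finset.sum_congr rfl fun sd _ => ?_
    rw [Finset.mul_sum]
    exact Finset.sum_congr rfl fun sa _ => by ring
  rw [Ud0, Ua0, Ud, Ua, hcard, hattack, ← Finset.sum_add_distrib, ← Finset.sum_add_distrib,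
    ← Finset.sum_neg_distrib]
  refine Finset.sum_congr rfl fun sd _ => ?_
  rw [← Finset.sum_add_distrib, ← Finset.sum_add_distrib, ← Finset.sum_neg_distrib]
  exact Finset.sum_congr rfl fun sa _ => by ring

theorem isNE_iff_isNE0 (C0 : ℝ) (Ce : E → ℝ) (pa pd : ℝ) (σd : Finset E → ℝ)
    (σa : Option E → ℝ) : IsNE C0 Ce pa pd σd σa ↔ IsNE0 C0 Ce pa pd σd σa := by
  refine and_congr_right fun hd => and_congr_right fun ha => and_congr ?_ ?_
  · refine forall₂_congr fun σd' hd' => ?_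
    rw [Ud0_eq_Ud_add C0 Ce pa pd hd ha, Ud0_eq_Ud_add C0 Ce pa pd hd' ha, add_le_add_iff_right]
  · refine forall₂_congr fun σa' _ => ?_
    rw [Ua0, Ua0, add_le_add_iff_right]

/-- Nash equilibria of the zero-sum game Γ0 are interchangeable. -/
theorem IsNE0.interchange {C0 : ℝ} {Ce : E → ℝ} {pa pd : ℝ} {σd₁ σd₂ : Finset E → ℝ}
    {σa₁ σa₂ : Option E → ℝ} (h₁ : IsNE0 C0 Ce pa pd σd₁ σa₁)
    (h₂ : IsNE0 C0 Ce pa pd σd₂ σa₂) : IsNE0 C0 Ce pa pd σd₁ σa₂ := by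
  obtain ⟨hd₁, ha₁, hD₁, hA₁⟩ := h₁
  obtain ⟨hd₂, ha₂, hD₂, hA₂⟩ := h₂
  simp only [Ud0, neg_le_neg_iff] at hD₁ hD₂
  refine ⟨hd₁, ha₂, fun σd hd => ?_, fun σa ha => ?_⟩
  · simp only [Ud0, neg_le_neg_iff]
    linarith [hD₁ σd₂ hd₂, hA₁ σa₂ ha₂, hA₂ σa₁ ha₁, hD₂ σd hd]
  · linarith [hD₁ σd₂ hd₂, hA₁ σa ha, hA₂ σa₁ ha₁, hD₂ σd₁ hd₁]

/-- **Lemma 2 (strategic equivalence to a zero-sum game and interchangeability).**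
A profile is a Nash equilibrium of Γ iff it is a Nash equilibrium of the zero-sum game Γ0;
consequently Nash equilibria of Γ are interchangeable. -/
theorem NE_iff_NE0_and_interchangeable {E : Type*} [Fintype E] [DecidableEq E] [Nonempty E]
    (C0 : ℝ) (Ce : E → ℝ) (pa pd : ℝ) (hpa : 0 < pa) (hpd : 0 < pd) :
    (∀ (σd : Finset E → ℝ) (σa : Option E → ℝ),
      IsNE C0 Ce pa pd σd σa ↔ IsNE0 C0 Ce pa pd σd σa) ∧
    (∀ (σd₁ : Finset E → ℝ) (σa₁ : Option E → ℝ) (σd₂ : Finset E → ℝ) (σa₂ : Option E → ℝ),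
      IsNE C0 Ce pa pd σd₁ σa₁ → IsNE C0 Ce pa pd σd₂ σa₂ →
      IsNE C0 Ce pa pd σd₁ σa₂ ∧ IsNE C0 Ce pa pd σd₂ σa₁) := by
  refine ⟨isNE_iff_isNE0 C0 Ce pa pd, fun σd₁ σa₁ σd₂ σa₂ h₁ h₂ => ?_⟩
  simp only [isNE_iff_isNE0] at h₁ h₂ ⊢
  exact ⟨h₁.interchange h₂, h₂.interchange h₁⟩

end SecGame
end
end

section
/- Assume Ē ≠ ∅. For an attacker mixed strategy σa with σa(e) = 0 for all e ∉ Ē, define V(σa) = ∑_{e∈Ē} min{ σa(e)·(C0−pa) + pd , σa(e)·(C_e−pa) } + σa(∅)·C0. Then an attacker mixed strategy σa* is an attacker equilibrium strategy of Γ (i.e., there exists σd* such that (σd*, σa*) is a Nash equilibrium of Γ) if and only if σa*(e) = 0 for all e ∉ Ē and σa* maximizes V over all attacker mixed strategies that vanish outside Ē ∪ {∅}. -/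
open Finset

noncomputable section

namespace SecGame

variable {E : Type*} [Fintype E] [DecidableEq E]

/-- The piecewise-linear objective `V(σa)` from Proposition 2:
`V(σa) = ∑_{e ∈ Ē} min{σa(e)(C0−pa)+pd, σa(e)(C_e−pa)} + σa(∅)·C0`. -/
def Vobj (C0 : ℝ) (Ce : E → ℝ) (pa pd : ℝ) (σa : Option E → ℝ) : ℝ :=
  (∑ e ∈ Finset.univ.filter (fun e => C0 < Ce e),
    min (σa (some e) * (C0 - pa) + pd) (σa (some e) * (Ce e - pa))) + σa none * C0

/-- Any finite zero-sum game has a saddle point in mixed strategies. -/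
theorem exists_mixed_saddle {ι κ : Type*} [Fintype ι] [Fintype κ] [Nonempty ι] [Nonempty κ]
    (M : ι → κ → ℝ) :
    ∃ a ∈ stdSimplex ℝ ι, ∃ b ∈ stdSimplex ℝ κ,
      IsSaddlePointOn (stdSimplex ℝ ι) (stdSimplex ℝ κ)
        (fun x y => ∑ i, ∑ j, x i * y j * M i j) a b := by
  classical
  refine Sion.exists_isSaddlePointOn ⟨_, single_mem_stdSimplex ℝ (Classical.arbitrary ι)⟩
    (convex_stdSimplex ℝ ι) (isCompact_stdSimplex ℝ ι) ?_ ?_ (convex_stdSimplex ℝ κ)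
    ⟨_, single_mem_stdSimplex ℝ (Classical.arbitrary κ)⟩ (isCompact_stdSimplex ℝ κ) ?_ ?_
  · intro y _
    exact (Continuous.continuousOn (by fun_prop)).lowerSemicontinuousOn
  · intro y _
    refine ConvexOn.quasiconvexOn ⟨convex_stdSimplex ℝ ι, fun u _ v _ s t _ _ _ => le_of_eq ?_⟩
    simp only [Pi.add_apply, Pi.smul_apply, smul_eq_mul, Finset.mul_sum, ← Finset.sum_add_distrib]
    exact Finset.sum_congr rfl fun i _ => Finset.sum_congr rfl fun j _ => by ring
  · intro x _
    exact (Continuous.continuousOn (by fun_prop)).upperSemicontinuousOn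
  · intro x _
    refine ConcaveOn.quasiconcaveOn ⟨convex_stdSimplex ℝ κ, fun u _ v _ s t _ _ _ => le_of_eq ?_⟩
    simp only [Pi.add_apply, Pi.smul_apply, smul_eq_mul, Finset.mul_sum, ← Finset.sum_add_distrib]
    exact Finset.sum_congr rfl fun i _ => Finset.sum_congr rfl fun j _ => by ring

/-- Payoff matrix of the zero-sum game strategically equivalent to Γ. -/
def zeroSumCost (C0 : ℝ) (Ce : E → ℝ) (pa pd : ℝ) (sd : Finset E) (sa : Option E) : ℝ :=
  usageCost C0 Ce sd sa - pa * (if sa = none then 0 else 1) + pd * (sd.card : ℝ)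

/-- Expected payoff, to the attacker, of the zero-sum game strategically equivalent to Γ. -/
def zeroSumPayoff (C0 : ℝ) (Ce : E → ℝ) (pa pd : ℝ) (σd : Finset E → ℝ) (σa : Option E → ℝ) : ℝ :=
  ∑ sd : Finset E, ∑ sa : Option E, σd sd * σa sa * zeroSumCost C0 Ce pa pd sd sa

theorem zeroSumPayoff_eq_sum (C0 : ℝ) (Ce : E → ℝ) (pa pd : ℝ) (σd : Finset E → ℝ)
    (σa : Option E → ℝ) :
    zeroSumPayoff C0 Ce pa pd σd σa =
      ∑ sd, σd sd * ∑ sa, σa sa * zeroSumCost C0 Ce pa pd sd sa := by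
  simp only [zeroSumPayoff, Finset.mul_sum, mul_assoc]

theorem zeroSumPayoff_eq_Ua_add (C0 : ℝ) (Ce : E → ℝ) (pa pd : ℝ) (σd : Finset E → ℝ)
    {σa : Option E → ℝ} (ha : IsAtkMixed σa) :
    zeroSumPayoff C0 Ce pa pd σd σa =
      Ua C0 Ce pa σd σa + ∑ sd : Finset E, σd sd * (pd * (sd.card : ℝ)) := by
  have h : ∀ sd : Finset E, σd sd * (pd * (sd.card : ℝ)) =
      ∑ sa, σd sd * σa sa * (pd * (sd.card : ℝ)) := fun sd => by
    rw [← Finset.sum_mul, ← Finset.mul_sum, ha.2, mul_one]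
  simp only [zeroSumPayoff, zeroSumCost, Ua, h, ← Finset.sum_add_distrib]
  exact Finset.sum_congr rfl fun _ _ => Finset.sum_congr rfl fun _ _ => by ring

theorem zeroSumPayoff_eq_neg_Ud_sub (C0 : ℝ) (Ce : E → ℝ) (pa pd : ℝ) {σd : Finset E → ℝ}
    (hd : IsDefMixed σd) (σa : Option E → ℝ) :
    zeroSumPayoff C0 Ce pa pd σd σa =
      -Ud C0 Ce pd σd σa - ∑ sa, σa sa * (pa * (if sa = none then 0 else 1)) := by
  have h : ∀ sa : Option E, σa sa * (pa * (if sa = none then 0 else 1)) =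
      ∑ sd, σd sd * σa sa * (pa * (if sa = none then 0 else 1)) := fun sa => by
    rw [← Finset.sum_mul, ← Finset.sum_mul, hd.2, one_mul]
  rw [Finset.sum_congr rfl fun sa _ => h sa, Finset.sum_comm]
  simp only [zeroSumPayoff, zeroSumCost, Ud, ← Finset.sum_neg_distrib, ← Finset.sum_sub_distrib]
  exact Finset.sum_congr rfl fun _ _ => Finset.sum_congr rfl fun _ _ => by ring

theorem isNE_iff_isSaddlePointOn (C0 : ℝ) (Ce : E → ℝ) (pa pd : ℝ) (σd : Finset E → ℝ)
    (σa : Option E → ℝ) :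
    IsNE C0 Ce pa pd σd σa ↔ IsDefMixed σd ∧ IsAtkMixed σa ∧
      IsSaddlePointOn (stdSimplex ℝ (Finset E)) (stdSimplex ℝ (Option E))
        (zeroSumPayoff C0 Ce pa pd) σd σa := by
  refine and_congr_right fun hd => and_congr_right fun ha => ⟨fun ⟨h₁, h₂⟩ x hx y hy => ?_,
    fun h => ⟨fun x hx => ?_, fun y hy => ?_⟩⟩
  · have hx' := h₁ x hx
    have hy' := h₂ y hy
    have e₁ := zeroSumPayoff_eq_neg_Ud_sub C0 Ce pa pd hx σa
    have e₂ := zeroSumPayoff_eq_neg_Ud_sub C0 Ce pa pd hd σa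
    have e₃ := zeroSumPayoff_eq_Ua_add C0 Ce pa pd σd hy
    have e₄ := zeroSumPayoff_eq_Ua_add C0 Ce pa pd σd ha
    linarith
  · have := h x hx σa ha
    rw [zeroSumPayoff_eq_neg_Ud_sub C0 Ce pa pd hx,
      zeroSumPayoff_eq_neg_Ud_sub C0 Ce pa pd hd] at this
    linarith
  · have := h σd hd y hy
    rw [zeroSumPayoff_eq_Ua_add C0 Ce pa pd σd hy, zeroSumPayoff_eq_Ua_add C0 Ce pa pd σd ha]
      at this
    linarith

theorem sum_mul_zeroSumCost (C0 : ℝ) (Ce : E → ℝ) (pa pd : ℝ) (sd : Finset E)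
    {σa : Option E → ℝ} (ha : IsAtkMixed σa) :
    ∑ sa, σa sa * zeroSumCost C0 Ce pa pd sd sa =
      (∑ e, if e ∈ sd then σa (some e) * (C0 - pa) + pd else σa (some e) * (Ce e - pa))
        + σa none * C0 := by
  have hcard : (sd.card : ℝ) = ∑ e, if e ∈ sd then 1 else 0 := by simp
  simp only [zeroSumCost, mul_add, Finset.sum_add_distrib, ← Finset.sum_mul, ha.2, one_mul]
  rw [Fintype.sum_option, hcard, Finset.mul_sum, add_assoc, add_comm, add_assoc,
    ← add_assoc, ← Finset.sum_add_distrib, add_comm (∑ _, _)]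
  simp only [usageCost, if_true, reduceCtorEq, if_false, mul_zero, sub_zero, mul_one]
  rw [add_comm]
  congr 1
  exact Finset.sum_congr rfl fun e _ => by split_ifs <;> ring

theorem Vobj_le_zeroSumPayoff {C0 : ℝ} {Ce : E → ℝ} {pa pd : ℝ} (hpd : 0 ≤ pd)
    {σd : Finset E → ℝ} (hd : IsDefMixed σd) {σa : Option E → ℝ} (ha : IsAtkMixed σa)
    (hσa : ∀ e, ¬ C0 < Ce e → σa (some e) = 0) :
    Vobj C0 Ce pa pd σa ≤ zeroSumPayoff C0 Ce pa pd σd σa := by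
  have hpure : ∀ sd, Vobj C0 Ce pa pd σa ≤ ∑ sa, σa sa * zeroSumCost C0 Ce pa pd sd sa := by
    intro sd
    rw [sum_mul_zeroSumCost C0 Ce pa pd sd ha, Vobj, Finset.sum_filter]
    gcongr with e
    by_cases he : C0 < Ce e
    · rw [if_pos he]
      split_ifs
      · exact min_le_left _ _
      · exact min_le_right _ _
    · rw [if_neg he, hσa e he]
      split_ifs <;> simp [hpd]
  rw [zeroSumPayoff_eq_sum]
  calc Vobj C0 Ce pa pd σa = ∑ sd, σd sd * Vobj C0 Ce pa pd σa := by
        rw [← Finset.sum_mul, hd.2, one_mul]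
    _ ≤ _ := Finset.sum_le_sum fun sd _ => mul_le_mul_of_nonneg_left (hpure sd) (hd.1 sd)

theorem exists_zeroSumPayoff_eq_Vobj (C0 : ℝ) (Ce : E → ℝ) (pa pd : ℝ)
    {σa : Option E → ℝ} (ha : IsAtkMixed σa) (hσa : ∀ e, ¬ C0 < Ce e → σa (some e) = 0) :
    ∃ σd, IsDefMixed σd ∧ zeroSumPayoff C0 Ce pa pd σd σa = Vobj C0 Ce pa pd σa := by
  let sd : Finset E := Finset.univ.filter fun e =>
    C0 < Ce e ∧ σa (some e) * (C0 - pa) + pd ≤ σa (some e) * (Ce e - pa)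
  refine ⟨Pi.single sd 1, single_mem_stdSimplex ℝ sd, ?_⟩
  rw [zeroSumPayoff_eq_sum, Finset.sum_eq_single sd (fun b _ hb => by simp [hb]) (by simp),
    Pi.single_eq_same, one_mul, sum_mul_zeroSumCost C0 Ce pa pd sd ha, Vobj, Finset.sum_filter]
  congr 1
  refine Finset.sum_congr rfl fun e _ => ?_
  by_cases he : C0 < Ce e
  · by_cases hle : σa (some e) * (C0 - pa) + pd ≤ σa (some e) * (Ce e - pa)
    · simp only [sd, Finset.mem_filter, Finset.mem_univ, he, hle, if_true, min_eq_left,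
        and_self]
    · simp only [sd, Finset.mem_filter, Finset.mem_univ, he, hle, if_true, if_false,
        and_false, min_eq_right (not_le.mp hle).le]
  · simp [sd, he, hσa e he]

/-- Attacking a non-vulnerable facility is strictly dominated by not attacking. -/
theorem eq_zero_of_isSaddlePointOn {C0 : ℝ} {Ce : E → ℝ} {pa pd : ℝ} (hpa : 0 < pa)
    {σd : Finset E → ℝ} (hd : IsDefMixed σd) {σa : Option E → ℝ} (ha : IsAtkMixed σa)
    (h : IsSaddlePointOn (stdSimplex ℝ (Finset E)) (stdSimplex ℝ (Option E))
      (zeroSumPayoff C0 Ce pa pd) σd σa) {e : E} (he : ¬ C0 < Ce e) : σa (some e) = 0 := by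
  set x := σa (some e) with hx
  have hx0 : 0 ≤ x := ha.1 _
  let δ : Option E → ℝ := Pi.single none 1 - Pi.single (some e) 1
  have hmem : σa + x • δ ∈ stdSimplex ℝ (Option E) := by
    refine ⟨fun sa => ?_, ?_⟩
    · have hsa := ha.1 sa
      rcases sa with _ | e'
      · simpa [δ] using add_nonneg hsa hx0
      · by_cases h' : e' = e
        · subst h'
          simp [δ, x]
        · simpa [δ, h'] using hsa
    · simp [δ, Finset.sum_add_distrib, ← Finset.mul_sum, ha.2]
  have hle := h σd hd _ hmem
  have hgain : ∀ sd, pa ≤ ∑ sa, δ sa * zeroSumCost C0 Ce pa pd sd sa := by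
    intro sd
    have : ∑ sa, δ sa * zeroSumCost C0 Ce pa pd sd sa =
        zeroSumCost C0 Ce pa pd sd none - zeroSumCost C0 Ce pa pd sd (some e) := by
      simp [δ, sub_mul, Pi.single_apply]
    rw [this]
    simp only [zeroSumCost, usageCost, if_true, reduceCtorEq, if_false]
    split_ifs <;> linarith
  have hsplit : zeroSumPayoff C0 Ce pa pd σd (σa + x • δ) = zeroSumPayoff C0 Ce pa pd σd σa +
      x * ∑ sd, σd sd * ∑ sa, δ sa * zeroSumCost C0 Ce pa pd sd sa := by
    simp only [zeroSumPayoff, Pi.add_apply, Pi.smul_apply, smul_eq_mul, Finset.mul_sum,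
      ← Finset.sum_add_distrib]
    exact Finset.sum_congr rfl fun _ _ => Finset.sum_congr rfl fun _ _ => by ring
  have hpos : pa ≤ ∑ sd, σd sd * ∑ sa, δ sa * zeroSumCost C0 Ce pa pd sd sa := by
    calc pa = ∑ sd, σd sd * pa := by rw [← Finset.sum_mul, hd.2, one_mul]
      _ ≤ _ := Finset.sum_le_sum fun sd _ => mul_le_mul_of_nonneg_left (hgain sd) (hd.1 sd)
  rw [hsplit] at hle
  nlinarith [mul_le_mul_of_nonneg_left hpos hx0]

/-- At a saddle point the attacker's strategy attains `V` as the saddle value. -/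
theorem zeroSumPayoff_eq_Vobj_of_isSaddlePointOn {C0 : ℝ} {Ce : E → ℝ} {pa pd : ℝ}
    (hpd : 0 ≤ pd) {σd : Finset E → ℝ} (hd : IsDefMixed σd) {σa : Option E → ℝ}
    (ha : IsAtkMixed σa) (hσa : ∀ e, ¬ C0 < Ce e → σa (some e) = 0)
    (h : IsSaddlePointOn (stdSimplex ℝ (Finset E)) (stdSimplex ℝ (Option E))
      (zeroSumPayoff C0 Ce pa pd) σd σa) :
    zeroSumPayoff C0 Ce pa pd σd σa = Vobj C0 Ce pa pd σa := by
  obtain ⟨τ, hτ, hτV⟩ := exists_zeroSumPayoff_eq_Vobj C0 Ce pa pd ha hσa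
  exact le_antisymm (hτV ▸ h τ hτ σa ha) (Vobj_le_zeroSumPayoff hpd hd ha hσa)

/-- **Proposition 2 (attacker equilibrium strategies solve a max-min program).**
Assume `Ē ≠ ∅`. An attacker mixed strategy `σa*` is an attacker equilibrium strategy of Γ
(i.e. part of some Nash equilibrium) iff it vanishes outside `Ē ∪ {∅}` and it maximizes
`V` over all attacker mixed strategies vanishing outside `Ē ∪ {∅}`. -/
theorem attacker_NE_iff_maximizes_V {E : Type*} [Fintype E] [DecidableEq E] [Nonempty E]
    (C0 : ℝ) (Ce : E → ℝ) (pa pd : ℝ) (hpa : 0 < pa) (hpd : 0 < pd)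
    (hEbar : ∃ e : E, C0 < Ce e)
    (σastar : Option E → ℝ) :
    (∃ σd : Finset E → ℝ, IsNE C0 Ce pa pd σd σastar) ↔
      (IsAtkMixed σastar ∧
       (∀ e : E, ¬ C0 < Ce e → σastar (some e) = 0) ∧
       (∀ σa : Option E → ℝ, IsAtkMixed σa → (∀ e : E, ¬ C0 < Ce e → σa (some e) = 0) →
         Vobj C0 Ce pa pd σa ≤ Vobj C0 Ce pa pd σastar)) := by
  simp only [isNE_iff_isSaddlePointOn]
  constructor
  · rintro ⟨σd, hd, ha, h⟩
    have hvan : ∀ e, ¬ C0 < Ce e → σastar (some e) = 0 :=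
      fun e he => eq_zero_of_isSaddlePointOn hpa hd ha h he
    refine ⟨ha, hvan, fun σa hσa hσa0 => ?_⟩
    calc Vobj C0 Ce pa pd σa ≤ zeroSumPayoff C0 Ce pa pd σd σa :=
          Vobj_le_zeroSumPayoff hpd.le hd hσa hσa0
      _ ≤ zeroSumPayoff C0 Ce pa pd σd σastar := h σd hd σa hσa
      _ = Vobj C0 Ce pa pd σastar :=
          zeroSumPayoff_eq_Vobj_of_isSaddlePointOn hpd.le hd ha hvan h
  · rintro ⟨ha, hvan, hmax⟩
    obtain ⟨σd, hd, τ, hτ, h⟩ := exists_mixed_saddle (zeroSumCost C0 Ce pa pd)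
    change IsSaddlePointOn _ _ (zeroSumPayoff C0 Ce pa pd) σd τ at h
    have hτvan : ∀ e, ¬ C0 < Ce e → τ (some e) = 0 :=
      fun e he => eq_zero_of_isSaddlePointOn hpa hd hτ h he
    refine ⟨σd, hd, ha, fun x hx y hy => ?_⟩
    calc zeroSumPayoff C0 Ce pa pd σd y ≤ zeroSumPayoff C0 Ce pa pd σd τ := h σd hd y hy
      _ = Vobj C0 Ce pa pd τ := zeroSumPayoff_eq_Vobj_of_isSaddlePointOn hpd.le hd hτ hτvan h
      _ ≤ Vobj C0 Ce pa pd σastar := hmax τ hτ hτvan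
      _ ≤ zeroSumPayoff C0 Ce pa pd x σastar := Vobj_le_zeroSumPayoff hpd.le hx ha hvan

end SecGame
end
end

section
/- Let σa be any attacker mixed strategy and let σd be a best response of the defender to σa (i.e., σd maximizes Ud(·,σa)), with induced security effort vector ρ. Then for every e ∈ E: ρ_e = 0 whenever e ∉ Ē, or e ∈ Ē and σa(e) < pd/(C_e−C0); and ρ_e = 1 whenever e ∈ Ē and σa(e) > pd/(C_e−C0). -/
open Finset

noncomputable section

namespace SecGame

variable {E : Type*} [Fintype E] [DecidableEq E]

/-- Defender expected utility of the pure strategy `sd`. -/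
def purePayoff (C0 : ℝ) (Ce : E → ℝ) (pd : ℝ) (σa : Option E → ℝ) (sd : Finset E) : ℝ :=
  ∑ sa : Option E, σa sa * (-(usageCost C0 Ce sd sa) - pd * (sd.card : ℝ))

theorem Ud_eq_sum_purePayoff (C0 : ℝ) (Ce : E → ℝ) (pd : ℝ) (σd : Finset E → ℝ)
    (σa : Option E → ℝ) :
    Ud C0 Ce pd σd σa = ∑ sd : Finset E, σd sd * purePayoff C0 Ce pd σa sd := by
  simp only [Ud, purePayoff, Finset.mul_sum, mul_assoc]

theorem purePayoff_insert (C0 : ℝ) (Ce : E → ℝ) (pd : ℝ) {σa : Option E → ℝ}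
    (hσa : IsAtkMixed σa) {e : E} {s : Finset E} (he : e ∉ s) :
    purePayoff C0 Ce pd σa (insert e s) =
      purePayoff C0 Ce pd σa s + (σa (some e) * (Ce e - C0) - pd) := by
  have key : ∀ sa : Option E,
      σa sa * (-(usageCost C0 Ce (insert e s) sa) - pd * ((insert e s).card : ℝ)) =
        σa sa * (-(usageCost C0 Ce s sa) - pd * (s.card : ℝ)) +
          ((if sa = some e then σa sa * (Ce e - C0) else 0) - pd * σa sa) := by
    rintro (_ | f)
    · simp [usageCost, Finset.card_insert_of_notMem he]
      ring
    · by_cases hf : f = e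
      · subst hf
        simp [usageCost, Finset.card_insert_of_notMem he, he]
        ring
      · simp [usageCost, Finset.card_insert_of_notMem he, hf]
        ring
  simp only [purePayoff]
  rw [Finset.sum_congr rfl fun sa _ => key sa, Finset.sum_add_distrib, Finset.sum_sub_distrib,
    ← Finset.mul_sum, hσa.2, Finset.sum_ite_eq' Finset.univ (some e)]
  simp

/-- A best response puts no mass on a pure strategy that another one strictly beats. -/
theorem eq_zero_of_purePayoff_lt {C0 : ℝ} {Ce : E → ℝ} {pd : ℝ} {σa : Option E → ℝ}
    {σd : Finset E → ℝ} (hσd : IsDefMixed σd)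
    (hBR : ∀ σd' : Finset E → ℝ, IsDefMixed σd' → Ud C0 Ce pd σd' σa ≤ Ud C0 Ce pd σd σa)
    {s t : Finset E} (hst : purePayoff C0 Ce pd σa s < purePayoff C0 Ce pd σa t) :
    σd s = 0 := by
  have hne : s ≠ t := by
    rintro rfl
    exact lt_irrefl _ hst
  have hmixed : IsDefMixed fun u =>
      σd u + ((if u = t then σd s else 0) - (if u = s then σd s else 0)) := by
    refine ⟨fun u => ?_, ?_⟩
    · have hu := hσd.1 u
      have hs := hσd.1 s
      dsimp only
      by_cases hus : u = s
      · subst hus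
        simp [hne]
      · rw [if_neg hus]
        split_ifs <;> linarith
    · simp [Finset.sum_add_distrib, Finset.sum_sub_distrib, hσd.2]
  have h := hBR _ hmixed
  simp only [Ud_eq_sum_purePayoff, add_mul, sub_mul, ite_mul, zero_mul, Finset.sum_add_distrib,
    Finset.sum_sub_distrib, Finset.sum_ite_eq', Finset.mem_univ, if_true] at h
  have hs := hσd.1 s
  nlinarith

/-- **Lemma 3, first part (defender's best response).**
If `σd` is a best response to the attacker strategy `σa` and `ρ = effort σd`, then
`ρ_e = 0` whenever `e ∉ Ē` or `e ∈ Ē` with `σa(e) < pd/(C_e−C0)`, and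
`ρ_e = 1` whenever `e ∈ Ē` with `σa(e) > pd/(C_e−C0)`. -/
theorem defender_best_response_effort {E : Type*} [Fintype E] [DecidableEq E] [Nonempty E]
    (C0 : ℝ) (Ce : E → ℝ) (pa pd : ℝ) (hpa : 0 < pa) (hpd : 0 < pd)
    (σa : Option E → ℝ) (hσa : IsAtkMixed σa)
    (σd : Finset E → ℝ) (hσd : IsDefMixed σd)
    (hBR : ∀ σd' : Finset E → ℝ, IsDefMixed σd' →
      Ud C0 Ce pd σd' σa ≤ Ud C0 Ce pd σd σa) :
    ∀ e : E,
      ((¬ C0 < Ce e) ∨ (C0 < Ce e ∧ σa (some e) < pd / (Ce e - C0)) → effort σd e = 0) ∧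
      (C0 < Ce e ∧ pd / (Ce e - C0) < σa (some e) → effort σd e = 1) := by
  intro e
  constructor
  · intro h
    have hlt : σa (some e) * (Ce e - C0) - pd < 0 := by
      rcases h with h | ⟨h, h'⟩
      · nlinarith [hσa.1 (some e), not_lt.mp h]
      · linarith [(lt_div_iff₀ (sub_pos.mpr h)).mp h']
    refine Finset.sum_eq_zero fun s hs => ?_
    have hes : e ∈ s := (Finset.mem_filter.mp hs).2
    have hins := purePayoff_insert C0 Ce pd hσa (Finset.notMem_erase e s)
    rw [Finset.insert_erase hes] at hins
    exact eq_zero_of_purePayoff_lt hσd hBR (t := s.erase e) (by linarith)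
  · rintro ⟨h, h'⟩
    have hlt : 0 < σa (some e) * (Ce e - C0) - pd := by
      linarith [(div_lt_iff₀ (sub_pos.mpr h)).mp h']
    rw [← hσd.2]
    refine Finset.sum_subset (Finset.filter_subset _ _) fun s _ hs => ?_
    have hes : e ∉ s := by simpa using hs
    have hins := purePayoff_insert C0 Ce pd hσa hes
    exact eq_zero_of_purePayoff_lt hσd hBR (t := insert e s) (by linarith)

end SecGame
end
end

section
/- In every Nash equilibrium (σd*, σa*) of the normal-form game Γ, the attacker's strategy satisfies σa*(e) ≤ pd/(C_e−C0) for every e ∈ Ē, and σa*(e) = 0 for every e ∈ E ∖ Ē. -/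
open Finset

noncomputable section

namespace SecGame

variable {E : Type*} [Fintype E] [DecidableEq E]

/-- A mixed strategy that maximizes a linear payoff puts no mass on a dominated pure strategy. -/
theorem eq_zero_of_isBestResponse {α : Type*} [Fintype α] [DecidableEq α] {f σ : α → ℝ}
    (h0 : ∀ a, 0 ≤ σ a) (h1 : ∑ a, σ a = 1)
    (hmax : ∀ σ' : α → ℝ, (∀ a, 0 ≤ σ' a) → ∑ a, σ' a = 1 → ∑ a, σ' a * f a ≤ ∑ a, σ a * f a)
    {s t : α} (hst : f s < f t) : σ s = 0 := by
  have hne : s ≠ t := fun h => by simp [h] at hst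
  have key := hmax
    (fun a => σ a + (if a = t then σ s else 0) - (if a = s then σ s else 0)) ?_ ?_
  · simp only [sub_mul, add_mul, ite_mul, zero_mul, sum_sub_distrib, sum_add_distrib,
      sum_ite_eq', mem_univ, if_true] at key
    have hs := h0 s
    by_contra hz
    have : 0 < σ s := lt_of_le_of_ne hs (Ne.symm hz)
    nlinarith
  · intro a
    have ha := h0 a
    have hs := h0 s
    by_cases has : a = s
    · subst has
      simp [hne]
    · simp only [has, if_false, sub_zero]
      split_ifs <;> linarith
  · simp [sum_sub_distrib, sum_add_distrib, h1]

/-- Defender expected utility of a pure strategy. -/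
def pureUd (C0 : ℝ) (Ce : E → ℝ) (pd : ℝ) (σa : Option E → ℝ) (sd : Finset E) : ℝ :=
  ∑ sa : Option E, σa sa * (-(usageCost C0 Ce sd sa) - pd * (sd.card : ℝ))

/-- Attacker expected utility of a pure strategy. -/
def pureUa (C0 : ℝ) (Ce : E → ℝ) (pa : ℝ) (σd : Finset E → ℝ) (sa : Option E) : ℝ :=
  ∑ sd : Finset E, σd sd * (usageCost C0 Ce sd sa - pa * (if sa = none then 0 else 1))

theorem Ud_eq_sum_pureUd (C0 : ℝ) (Ce : E → ℝ) (pd : ℝ) (σd : Finset E → ℝ)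
    (σa : Option E → ℝ) : Ud C0 Ce pd σd σa = ∑ sd, σd sd * pureUd C0 Ce pd σa sd := by
  simp only [Ud, pureUd, mul_sum, mul_assoc]

theorem Ua_eq_sum_pureUa (C0 : ℝ) (Ce : E → ℝ) (pa : ℝ) (σd : Finset E → ℝ)
    (σa : Option E → ℝ) : Ua C0 Ce pa σd σa = ∑ sa, σa sa * pureUa C0 Ce pa σd sa := by
  rw [Ua, sum_comm]
  simp only [pureUa, mul_sum, mul_assoc, mul_left_comm]

theorem pureUd_insert_sub (C0 : ℝ) (Ce : E → ℝ) (pd : ℝ) {σa : Option E → ℝ}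
    (hσa : IsAtkMixed σa) {sd : Finset E} {e : E} (he : e ∉ sd) :
    pureUd C0 Ce pd σa (insert e sd) - pureUd C0 Ce pd σa sd
      = σa (some e) * (Ce e - C0) - pd := by
  have hterm : ∀ sa : Option E,
      σa sa * (-(usageCost C0 Ce (insert e sd) sa) - pd * ((insert e sd).card : ℝ))
        - σa sa * (-(usageCost C0 Ce sd sa) - pd * (sd.card : ℝ))
      = (if sa = some e then σa (some e) * (Ce e - C0) else 0) - σa sa * pd := by
    intro sa
    rw [card_insert_of_notMem he]
    push_cast
    rcases sa with _ | x
    · simp only [usageCost, reduceCtorEq, if_false]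
      ring
    · by_cases hx : x = e
      · subst hx
        simp only [usageCost, mem_insert_self, if_true, he, if_false]
        ring
      · simp only [usageCost, mem_insert, hx, false_or, Option.some.injEq, if_false]
        ring
  rw [pureUd, pureUd, ← sum_sub_distrib, sum_congr rfl fun sa _ => hterm sa, sum_sub_distrib,
    ← sum_mul, hσa.2]
  simp

/-- A facility whose attack never raises the usage cost against `σd` is not attacked. -/
theorem IsNE.attack_eq_zero {C0 : ℝ} {Ce : E → ℝ} {pa pd : ℝ} (hpa : 0 < pa)
    {σd : Finset E → ℝ} {σa : Option E → ℝ} (hNE : IsNE C0 Ce pa pd σd σa) {e : E}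
    (he : ∀ sd, σd sd ≠ 0 → usageCost C0 Ce sd (some e) ≤ C0) : σa (some e) = 0 := by
  obtain ⟨hd, ha, -, hbest⟩ := hNE
  refine eq_zero_of_isBestResponse (f := pureUa C0 Ce pa σd) (t := none) ha.1 ha.2 ?_ ?_
  · intro σ' h0 h1
    simpa only [Ua_eq_sum_pureUa] using hbest σ' ⟨h0, h1⟩
  · have hnone : pureUa C0 Ce pa σd none = C0 := by
      simp [pureUa, usageCost, ← sum_mul, hd.2]
    have hsome : pureUa C0 Ce pa σd (some e) ≤ ∑ sd, σd sd * (C0 - pa) := by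
      refine sum_le_sum fun sd _ => ?_
      by_cases hz : σd sd = 0
      · simp [hz]
      · have := he sd hz
        refine mul_le_mul_of_nonneg_left ?_ (hd.1 sd)
        simp only [reduceCtorEq, if_false]
        linarith
    rw [← sum_mul, hd.2] at hsome
    linarith

/-- A facility attacked with probability above the threshold is always defended. -/
theorem IsNE.mem_of_pd_lt {C0 : ℝ} {Ce : E → ℝ} {pa pd : ℝ}
    {σd : Finset E → ℝ} {σa : Option E → ℝ} (hNE : IsNE C0 Ce pa pd σd σa) {e : E}
    (he : pd < σa (some e) * (Ce e - C0)) {sd : Finset E} (hsd : σd sd ≠ 0) : e ∈ sd := by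
  obtain ⟨hd, ha, hbest, -⟩ := hNE
  by_contra hmem
  refine hsd (eq_zero_of_isBestResponse (f := pureUd C0 Ce pd σa) (t := insert e sd)
    hd.1 hd.2 ?_ ?_)
  · intro σ' h0 h1
    simpa only [Ud_eq_sum_pureUd] using hbest σ' ⟨h0, h1⟩
  · have := pureUd_insert_sub C0 Ce pd ha hmem
    linarith

/-- **Lemma 3, second part (equilibrium attack probabilities are bounded by the threshold).**
In every Nash equilibrium `(σd*, σa*)` of Γ, the attacker's strategy satisfies
`σa*(e) ≤ pd/(C_e−C0)` for every `e ∈ Ē`, and `σa*(e) = 0` for every `e ∉ Ē`. -/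
theorem NE_attack_probability_bounded {E : Type*} [Fintype E] [DecidableEq E] [Nonempty E]
    (C0 : ℝ) (Ce : E → ℝ) (pa pd : ℝ) (hpa : 0 < pa) (hpd : 0 < pd)
    (σd : Finset E → ℝ) (σa : Option E → ℝ)
    (hNE : IsNE C0 Ce pa pd σd σa) :
    (∀ e : E, C0 < Ce e → σa (some e) ≤ pd / (Ce e - C0)) ∧
    (∀ e : E, ¬ C0 < Ce e → σa (some e) = 0) := by
  refine ⟨fun e he => ?_, fun e he => hNE.attack_eq_zero hpa fun sd _ => ?_⟩
  · rw [le_div_iff₀ (sub_pos.2 he)]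
    by_contra! hlt
    have hzero : σa (some e) = 0 :=
      hNE.attack_eq_zero hpa fun sd hsd => by simp [usageCost, hNE.mem_of_pd_lt hlt hsd]
    rw [hzero, zero_mul] at hlt
    exact hlt.not_gt hpd
  · simp only [usageCost]
    split_ifs
    · exact le_rfl
    · exact not_lt.1 he

end SecGame
end
end

section
/- Suppose V ≠ ∅, pa ≠ C_e − C0 for every e ∈ E, and ∑_{e∈V} pd/(C_e−C0) < 1 (type I regime). Then (σd, σa) is a Nash equilibrium of Γ if and only if: the security effort vector ρ induced by σd satisfies ρ_e = (C_e−pa−C0)/(C_e−C0) for every e ∈ V and ρ_e = 0 for every e ∉ V; and σa(e) = pd/(C_e−C0) for every e ∈ V, σa(e) = 0 for every e ∈ E∖V, and σa(∅) = 1 − ∑_{e∈V} pd/(C_e−C0). -/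
open Finset

noncomputable section

namespace SecGame

variable {E : Type*} [Fintype E] [DecidableEq E]

/-- A mixed strategy maximizes expected utility iff every pure strategy in its support does. -/
theorem forall_mixed_le_iff {ι : Type*} [Fintype ι] {σ : ι → ℝ}
    (hσ : ∀ i, 0 ≤ σ i) (hσ1 : ∑ i, σ i = 1) (u : ι → ℝ) :
    (∀ σ' : ι → ℝ, (∀ i, 0 ≤ σ' i) ∧ ∑ i, σ' i = 1 → ∑ i, σ' i * u i ≤ ∑ i, σ i * u i) ↔
      ∀ i, 0 < σ i → ∀ j, u j ≤ u i := by
  classical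
  constructor
  · intro h i hi j
    have hM : ∀ k, u k ≤ ∑ i, σ i * u i := fun k => by
      have h1 := h (fun l => if l = k then 1 else 0) ⟨fun l => by split_ifs <;> norm_num, by simp⟩
      simpa using h1
    have h0 : ∑ k, σ k * ((∑ i, σ i * u i) - u k) = 0 := by
      simp only [mul_sub, Finset.sum_sub_distrib, ← Finset.sum_mul, hσ1, one_mul, sub_self]
    have h2 := (Finset.sum_eq_zero_iff_of_nonneg
      (fun k _ => mul_nonneg (hσ k) (sub_nonneg.2 (hM k)))).1 h0 i (Finset.mem_univ i)
    have h3 := (mul_eq_zero.1 h2).resolve_left hi.ne'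
    linarith [hM j]
  · rintro h σ' ⟨hσ', hσ'1⟩
    obtain ⟨i, hi⟩ : ∃ i, 0 < σ i := by
      by_contra! hc
      linarith [Finset.sum_nonpos (s := Finset.univ) (f := σ) fun i _ => hc i]
    have h1 : ∑ j, σ j * u j = u i := by
      rw [← one_mul (u i), ← hσ1, Finset.sum_mul]
      refine Finset.sum_congr rfl fun j _ => ?_
      rcases (hσ j).eq_or_lt with h0 | h0
      · simp [← h0]
      · rw [le_antisymm (h i hi j) (h j h0 i)]
    rw [h1, ← one_mul (u i), ← hσ'1, Finset.sum_mul]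
    exact Finset.sum_le_sum fun j _ => mul_le_mul_of_nonneg_left (h i hi j) (hσ' j)

theorem Ud_eq (C0 : ℝ) (Ce : E → ℝ) (pd : ℝ) (σd : Finset E → ℝ) {σa : Option E → ℝ}
    (ha : IsAtkMixed σa) :
    Ud C0 Ce pd σd σa = ∑ sd, σd sd *
      (∑ e ∈ sd, ((Ce e - C0) * σa (some e) - pd)
        - (C0 * σa none + ∑ e, Ce e * σa (some e))) := by
  have h1 := ha.2
  unfold Ud
  refine Finset.sum_congr rfl fun sd _ => ?_
  simp only [mul_assoc, ← Finset.mul_sum]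
  congr 1
  have h2 : ∀ e, σa (some e) * usageCost C0 Ce sd (some e)
      = Ce e * σa (some e) - if e ∈ sd then (Ce e - C0) * σa (some e) else 0 := fun e => by
    simp only [usageCost]
    split_ifs <;> ring
  simp only [mul_sub, mul_neg, Finset.sum_sub_distrib, Finset.sum_neg_distrib, ← Finset.sum_mul,
    h1, one_mul, Finset.sum_const, nsmul_eq_mul]
  rw [Fintype.sum_option]
  simp only [h2, Finset.sum_sub_distrib, Finset.sum_ite_mem, Finset.univ_inter]
  simp only [usageCost]
  ring

/-- Expected attacker utility of a pure attack when the security effort is `ρ`. -/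
def attackValue (C0 : ℝ) (Ce : E → ℝ) (pa : ℝ) (ρ : E → ℝ) : Option E → ℝ
  | some e => C0 + (1 - ρ e) * (Ce e - C0) - pa
  | none => C0

theorem Ua_eq (C0 : ℝ) (Ce : E → ℝ) (pa : ℝ) {σd : Finset E → ℝ} (hd : IsDefMixed σd)
    (σa : Option E → ℝ) :
    Ua C0 Ce pa σd σa = ∑ sa, σa sa * attackValue C0 Ce pa (effort σd) sa := by
  have h1 := hd.2
  unfold Ua
  rw [Finset.sum_comm]
  refine Finset.sum_congr rfl fun sa _ => ?_
  simp only [mul_comm _ (σa sa), mul_assoc, ← Finset.mul_sum]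
  congr 1
  cases sa with
  | none => simp [usageCost, attackValue, ← Finset.sum_mul, h1]
  | some e =>
    have h2 : ∀ sd, σd sd * usageCost C0 Ce sd (some e)
        = σd sd * Ce e - (if e ∈ sd then σd sd else 0) * (Ce e - C0) := fun sd => by
      simp only [usageCost]
      split_ifs <;> ring
    simp only [mul_sub, Finset.sum_sub_distrib, ← Finset.sum_mul, h1, h2, attackValue, effort,
      Finset.sum_filter]
    simp
    ring

theorem effort_nonneg {σd : Finset E → ℝ} (hd : IsDefMixed σd) (e : E) : 0 ≤ effort σd e :=
  Finset.sum_nonneg fun sd _ => hd.1 sd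

theorem effort_le_one {σd : Finset E → ℝ} (hd : IsDefMixed σd) (e : E) : effort σd e ≤ 1 := by
  rw [← hd.2]
  exact Finset.sum_le_sum_of_subset_of_nonneg (Finset.filter_subset _ _) fun sd _ _ => hd.1 sd

theorem effort_eq_zero_iff {σd : Finset E → ℝ} (hd : IsDefMixed σd) (e : E) :
    effort σd e = 0 ↔ ∀ sd, 0 < σd sd → e ∉ sd := by
  rw [effort, Finset.sum_eq_zero_iff_of_nonneg fun sd _ => hd.1 sd]
  simp only [Finset.mem_filter, Finset.mem_univ, true_and]
  exact ⟨fun h sd hs he => hs.ne' (h sd he),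
    fun h sd he => le_antisymm (not_lt.1 fun hs => h sd hs he) (hd.1 sd)⟩

theorem effort_eq_one {σd : Finset E → ℝ} (hd : IsDefMixed σd) {e : E}
    (h : ∀ sd, 0 < σd sd → e ∈ sd) : effort σd e = 1 := by
  rw [← hd.2, effort]
  refine Finset.sum_subset (Finset.filter_subset _ _) fun sd _ hs => ?_
  have he : e ∉ sd := by simpa using hs
  exact le_antisymm (not_lt.1 fun hp => he (h sd hp)) (hd.1 sd)

/-- The equilibrium condition in terms of the supports of the two mixed strategies. -/
theorem isNE_iff {C0 : ℝ} {Ce : E → ℝ} {pa pd : ℝ} {σd : Finset E → ℝ} {σa : Option E → ℝ}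
    (hd : IsDefMixed σd) (ha : IsAtkMixed σa) :
    IsNE C0 Ce pa pd σd σa ↔
      (∀ s, 0 < σd s → ∀ t, ∑ e ∈ t, ((Ce e - C0) * σa (some e) - pd)
        ≤ ∑ e ∈ s, ((Ce e - C0) * σa (some e) - pd)) ∧
      (∀ i, 0 < σa i → ∀ j, attackValue C0 Ce pa (effort σd) j
        ≤ attackValue C0 Ce pa (effort σd) i) := by
  have h1 := forall_mixed_le_iff hd.1 hd.2 fun sd =>
    ∑ e ∈ sd, ((Ce e - C0) * σa (some e) - pd) - (C0 * σa none + ∑ e, Ce e * σa (some e))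
  have h2 := forall_mixed_le_iff ha.1 ha.2 (attackValue C0 Ce pa (effort σd))
  simp only [sub_le_sub_iff_right] at h1
  rw [← h1, ← h2]
  simp only [IsNE, Ud_eq C0 Ce pd _ ha, Ua_eq C0 Ce pa hd]
  exact ⟨fun h => h.2.2, fun h => ⟨hd, ha, h⟩⟩

/-- **Theorem 1, type I regimes (relatively low defense cost).**
Assume the set of vulnerable facilities `V = {e : C_e − pa > C0}` is nonempty,
`pa ≠ C_e − C0` for every `e`, and `∑_{e∈V} pd/(C_e−C0) < 1`. Then `(σd,σa)` is a Nash
equilibrium of Γ iff the induced security effort is `(C_e−pa−C0)/(C_e−C0)` on each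
vulnerable facility and `0` elsewhere, the attacker targets each vulnerable facility with
the threshold probability `pd/(C_e−C0)`, no other facility, and does not attack with
the remaining probability. -/
theorem NE_characterization_typeI {E : Type*} [Fintype E] [DecidableEq E] [Nonempty E]
    (C0 : ℝ) (Ce : E → ℝ) (pa pd : ℝ) (hpa : 0 < pa) (hpd : 0 < pd)
    (hV : ∃ e : E, C0 < Ce e - pa)
    (hgen : ∀ e : E, pa ≠ Ce e - C0)
    (hsum : ∑ e ∈ Finset.univ.filter (fun e => C0 < Ce e - pa), pd / (Ce e - C0) < 1)
    (σd : Finset E → ℝ) (σa : Option E → ℝ) :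
    IsNE C0 Ce pa pd σd σa ↔
      (IsDefMixed σd ∧ IsAtkMixed σa ∧
       (∀ e : E, C0 < Ce e - pa → effort σd e = (Ce e - pa - C0) / (Ce e - C0)) ∧
       (∀ e : E, ¬ C0 < Ce e - pa → effort σd e = 0) ∧
       (∀ e : E, C0 < Ce e - pa → σa (some e) = pd / (Ce e - C0)) ∧
       (∀ e : E, ¬ C0 < Ce e - pa → σa (some e) = 0) ∧
       σa none = 1 - ∑ e ∈ Finset.univ.filter (fun e => C0 < Ce e - pa), pd / (Ce e - C0)) := by
  constructor
  · intro hNE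
    have hd := hNE.1
    have ha := hNE.2.1
    obtain ⟨hD, hA⟩ := (isNE_iff hd ha).1 hNE
    have hneg : ∀ e, (Ce e - C0) * σa (some e) < pd → effort σd e = 0 := by
      intro e he
      refine (effort_eq_zero_iff hd e).2 fun s hs hes => ?_
      have h1 := hD s hs (s.erase e)
      have h2 := Finset.add_sum_erase s (fun e => (Ce e - C0) * σa (some e) - pd) hes
      linarith
    have hpos : ∀ e, pd < (Ce e - C0) * σa (some e) → effort σd e = 1 := by
      intro e he
      refine effort_eq_one hd fun s hs => ?_
      by_contra hes
      have h1 := hD s hs (insert e s)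
      rw [Finset.sum_insert hes] at h1
      linarith
    have hmass : σa none + ∑ e, σa (some e) = 1 := by rw [← Fintype.sum_option]; exact ha.2
    have hnV : ∀ e, ¬ C0 < Ce e - pa → σa (some e) = 0 := by
      intro e he
      by_contra h0
      have h1 := hA (some e) ((ha.1 _).lt_of_ne' h0) none
      simp only [attackValue] at h1
      have h2 : Ce e - C0 < pa :=
        lt_of_le_of_ne (by linarith [not_lt.1 he]) (hgen e).symm
      have h3 := mul_nonneg (sub_nonneg.2 (effort_le_one hd e)) (sub_nonneg.2 h2.le)
      rcases (effort_nonneg hd e).eq_or_lt with h4 | h4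
      · rw [← h4] at h1
        linarith
      · linarith [mul_pos h4 hpa]
    have hsumV : ∑ e, σa (some e)
        = ∑ e ∈ Finset.univ.filter (fun e => C0 < Ce e - pa), σa (some e) := by
      symm
      refine Finset.sum_subset (Finset.filter_subset _ _) fun e _ he => hnV e ?_
      simpa using he
    have hle : ∀ e, (1 - effort σd e) * (Ce e - C0) ≤ pa := by
      intro f
      by_contra! hf
      have hsupp : ∀ i, 0 < σa i → C0 < attackValue C0 Ce pa (effort σd) i := fun i hi => by
        have h1 := hA i hi (some f)
        simp only [attackValue] at h1 ⊢
        linarith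
      have hnone : σa none = 0 := by
        by_contra h0
        exact lt_irrefl _ (hsupp none ((ha.1 _).lt_of_ne' h0))
      have hb : ∑ e ∈ Finset.univ.filter (fun e => C0 < Ce e - pa), σa (some e)
          ≤ ∑ e ∈ Finset.univ.filter (fun e => C0 < Ce e - pa), pd / (Ce e - C0) := by
        refine Finset.sum_le_sum fun e he => ?_
        have heV : C0 < Ce e - pa := by simpa using he
        rw [le_div_iff₀ (by linarith), mul_comm]
        by_contra! hc
        have h1 : 0 < σa (some e) := by
          by_contra! h0
          nlinarith
        have h2 := hsupp (some e) h1
        simp only [attackValue, hpos e hc] at h2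
        linarith
      linarith
    have hV' : ∀ e, C0 < Ce e - pa →
        effort σd e = (Ce e - pa - C0) / (Ce e - C0) ∧ σa (some e) = pd / (Ce e - C0) := by
      intro e he
      have hdpos : 0 < Ce e - C0 := by linarith
      have hge : pd ≤ (Ce e - C0) * σa (some e) := by
        by_contra! hc
        have h1 := hle e
        rw [hneg e hc] at h1
        linarith
      have h1 : 0 < σa (some e) := by
        by_contra! h0
        nlinarith
      have h2 := hA (some e) h1 none
      simp only [attackValue] at h2
      have h3 := hle e
      constructor
      · rw [eq_div_iff hdpos.ne']
        linarith
      · rw [eq_div_iff hdpos.ne', mul_comm]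
        refine le_antisymm ?_ hge
        by_contra! hc
        rw [hpos e hc] at h2
        linarith
    refine ⟨hd, ha, fun e he => (hV' e he).1, fun e he => hneg e ?_, fun e he => (hV' e he).2,
      hnV, ?_⟩
    · rw [hnV e he, mul_zero]
      exact hpd
    · rw [hsumV, Finset.sum_congr rfl fun e he => (hV' e (by simpa using he)).2] at hmass
      linarith
  · rintro ⟨hd, ha, hρV, hρn, haV, han, -⟩
    refine (isNE_iff hd ha).2 ⟨fun s hs t => ?_, fun i hi j => ?_⟩
    · have hwV : ∀ e, C0 < Ce e - pa → (Ce e - C0) * σa (some e) - pd = 0 := fun e he => by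
        have : Ce e - C0 ≠ 0 := by linarith
        rw [haV e he]
        field_simp
        ring
      refine (Finset.sum_nonpos fun e _ => ?_).trans (Finset.sum_nonneg fun e hes => ?_)
      · by_cases he : C0 < Ce e - pa
        · exact (hwV e he).le
        · rw [han e he]
          linarith
      · by_cases he : C0 < Ce e - pa
        · exact (hwV e he).ge
        · exact absurd hes ((effort_eq_zero_iff hd e).1 (hρn e he) s hs)
    · have hvV : ∀ e, C0 < Ce e - pa → attackValue C0 Ce pa (effort σd) (some e) = C0 := by
        intro e he
        have : Ce e - C0 ≠ 0 := by linarith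
        simp only [attackValue, hρV e he]
        field_simp
        ring
      have hi' : attackValue C0 Ce pa (effort σd) i = C0 := by
        rcases i with _ | e
        · rfl
        · exact hvV e (by_contra fun he => hi.ne' (han e he))
      rw [hi']
      rcases j with _ | e
      · exact le_rfl
      · by_cases he : C0 < Ce e - pa
        · exact (hvV e he).le
        · simp only [attackValue, hρn e he]
          linarith [not_lt.1 he]

end SecGame
end
end

section
/- Fix ρ ∈ [0,1]^E and assume pa ≠ C_e − C0 for every e ∈ E. (i) If ρ_e ≥ ρ̂_e for every vulnerable e ∈ V, then an attacker mixed strategy σa maximizes σa ↦ Ua(ρ,σa) if and only if σa(e) = 0 for every e ∉ E_ρ, where E_ρ := {e ∈ V : ρ_e = ρ̂_e} (mass on ∅ is unrestricted). (ii) Otherwise (there exists e ∈ V with ρ_e < ρ̂_e), σa maximizes σa ↦ Ua(ρ,σa) if and only if σa(∅) = 0 and σa(e) = 0 for every e outside argmax_{e ∈ V} ( ρ_e·C0 + (1−ρ_e)·C_e ). -/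
open Finset

noncomputable section

namespace SecGame

variable {E : Type*} [Fintype E] [DecidableEq E]

/-- The attacker's best-response property in the sequential game: `σa` is a mixed
strategy maximizing `Ua(ρ, ·)`. -/
def IsAtkBR (C0 : ℝ) (Ce : E → ℝ) (pa : ℝ) (ρ : E → ℝ) (σa : Option E → ℝ) : Prop :=
  IsAtkMixed σa ∧
  ∀ σa' : Option E → ℝ, IsAtkMixed σa' → UaRho C0 Ce pa ρ σa' ≤ UaRho C0 Ce pa ρ σa

/-- The attacker's expected payoff from a pure strategy against the effort vector `ρ`. -/
def atkPayoff (C0 : ℝ) (Ce : E → ℝ) (pa : ℝ) (ρ : E → ℝ) : Option E → ℝ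
  | some e => ρ e * C0 + (1 - ρ e) * Ce e - pa
  | none => C0

lemma UaRho_eq_sum_atkPayoff {ι : Type*} [Fintype ι]
    (C0 : ℝ) (Ce : ι → ℝ) (pa : ℝ) (ρ : ι → ℝ) (σa : Option ι → ℝ) :
    UaRho C0 Ce pa ρ σa = ∑ a, σa a * atkPayoff C0 Ce pa ρ a := by
  simp only [UaRho, Fintype.sum_option, atkPayoff, Finset.mul_sum]
  rw [add_sub_right_comm, ← Finset.sum_sub_distrib, add_comm, mul_comm]
  congr 1
  exact Finset.sum_congr rfl fun e _ => by ring

/-- A mixed strategy is a best response iff it avoids every suboptimal pure strategy. -/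
lemma isAtkBR_iff (C0 : ℝ) (Ce : E → ℝ) (pa : ℝ) (ρ : E → ℝ) (σa : Option E → ℝ)
    {m : Option E} (hm : ∀ a, atkPayoff C0 Ce pa ρ a ≤ atkPayoff C0 Ce pa ρ m) :
    IsAtkBR C0 Ce pa ρ σa ↔ IsAtkMixed σa ∧
      ∀ a, atkPayoff C0 Ce pa ρ a < atkPayoff C0 Ce pa ρ m → σa a = 0 := by
  have loss (σ : Option E → ℝ) (h : IsAtkMixed σ) :
      ∑ a, σ a * (atkPayoff C0 Ce pa ρ m - atkPayoff C0 Ce pa ρ a) =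
        atkPayoff C0 Ce pa ρ m - UaRho C0 Ce pa ρ σ := by
    simp only [mul_sub, Finset.sum_sub_distrib, ← Finset.sum_mul, h.2, one_mul,
      UaRho_eq_sum_atkPayoff]
  have loss_nonneg (σ : Option E → ℝ) (h : IsAtkMixed σ) (a : Option E) :
      0 ≤ σ a * (atkPayoff C0 Ce pa ρ m - atkPayoff C0 Ce pa ρ a) :=
    mul_nonneg (h.1 a) (sub_nonneg.2 (hm a))
  refine and_congr_right fun hσ => ⟨fun hbr a ha => ?_, fun hsupp σ' hσ' => ?_⟩
  · have hpure : IsAtkMixed (Pi.single m 1 : Option E → ℝ) :=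
      ⟨fun a => (Pi.single_nonneg.2 zero_le_one : (0 : Option E → ℝ) ≤ Pi.single m 1) a, by simp⟩
    have hle := hbr _ hpure
    rw [UaRho_eq_sum_atkPayoff C0 Ce pa ρ (Pi.single m 1)] at hle
    simp only [Pi.single_apply, ite_mul, one_mul, zero_mul, Finset.sum_ite_eq',
      Finset.mem_univ, if_true] at hle
    have hzero : ∑ a, σa a * (atkPayoff C0 Ce pa ρ m - atkPayoff C0 Ce pa ρ a) = 0 :=
      le_antisymm (by rw [loss σa hσ]; linarith)
        (Finset.sum_nonneg fun a _ => loss_nonneg σa hσ a)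
    have hterm := (Finset.sum_eq_zero_iff_of_nonneg
      fun a _ => loss_nonneg σa hσ a).1 hzero a (Finset.mem_univ a)
    exact (mul_eq_zero.1 hterm).resolve_right (sub_pos.2 ha).ne'
  · have hzero : ∑ a, σa a * (atkPayoff C0 Ce pa ρ m - atkPayoff C0 Ce pa ρ a) = 0 :=
      Finset.sum_eq_zero fun a _ => by
        rcases (hm a).lt_or_eq with h | h
        · rw [hsupp a h, zero_mul]
        · rw [h, sub_self, mul_zero]
    have hnonneg := Finset.sum_nonneg fun a (_ : a ∈ Finset.univ) => loss_nonneg σ' hσ' a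
    rw [loss σa hσ] at hzero
    rw [loss σ' hσ'] at hnonneg
    linarith

lemma atkPayoff_some_lt_of_not_vulnerable {ι : Type*} {C0 : ℝ} {Ce : ι → ℝ} {pa : ℝ} {ρ : ι → ℝ}
    (hpa : 0 < pa) (hρ : InBox ρ) {e : ι} (h : Ce e - pa < C0) :
    atkPayoff C0 Ce pa ρ (some e) < C0 := by
  obtain ⟨h0, h1⟩ := hρ e
  simp only [atkPayoff]
  rcases le_total C0 (Ce e) with hC | hC <;> nlinarith

lemma atkPayoff_some_lt_iff {ι : Type*} {C0 : ℝ} {Ce : ι → ℝ} {pa : ℝ} (ρ : ι → ℝ)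
    (hpa : 0 < pa) {e : ι} (h : C0 < Ce e - pa) :
    atkPayoff C0 Ce pa ρ (some e) < C0 ↔ rhoHat C0 Ce pa e < ρ e := by
  rw [rhoHat, div_lt_iff₀ (by linarith), atkPayoff]
  constructor <;> intro h <;> linarith

lemma lt_atkPayoff_some_iff {ι : Type*} {C0 : ℝ} {Ce : ι → ℝ} {pa : ℝ} (ρ : ι → ℝ)
    (hpa : 0 < pa) {e : ι} (h : C0 < Ce e - pa) :
    C0 < atkPayoff C0 Ce pa ρ (some e) ↔ ρ e < rhoHat C0 Ce pa e := by
  rw [rhoHat, lt_div_iff₀ (by linarith), atkPayoff]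
  constructor <;> intro h <;> linarith

/-- **Lemma 4 (attacker's best response correspondence in the sequential game).**
Fix `ρ ∈ [0,1]^E` and assume `pa ≠ C_e − C0` for every `e`.
(i) If `ρ_e ≥ ρ̂_e` on every vulnerable facility, then `σa` is a best response iff it puts
mass only on `E_ρ = {e ∈ V : ρ_e = ρ̂_e}` and on no-attack.
(ii) Otherwise, `σa` is a best response iff it puts no mass on no-attack and mass only on
the vulnerable facilities maximizing `ρ_e C0 + (1−ρ_e) C_e`. -/
theorem attacker_best_response_sequential {E : Type*} [Fintype E] [DecidableEq E] [Nonempty E]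
    (C0 : ℝ) (Ce : E → ℝ) (pa pd : ℝ) (hpa : 0 < pa) (hpd : 0 < pd)
    (hgen : ∀ e : E, pa ≠ Ce e - C0)
    (ρ : E → ℝ) (hρ : InBox ρ) :
    ((∀ e : E, C0 < Ce e - pa → rhoHat C0 Ce pa e ≤ ρ e) →
      ∀ σa : Option E → ℝ,
        (IsAtkBR C0 Ce pa ρ σa ↔
          (IsAtkMixed σa ∧
           ∀ e : E, ¬ (C0 < Ce e - pa ∧ ρ e = rhoHat C0 Ce pa e) → σa (some e) = 0))) ∧
    ((∃ e : E, C0 < Ce e - pa ∧ ρ e < rhoHat C0 Ce pa e) →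
      ∀ σa : Option E → ℝ,
        (IsAtkBR C0 Ce pa ρ σa ↔
          (IsAtkMixed σa ∧ σa none = 0 ∧
           ∀ e : E, ¬ (C0 < Ce e - pa ∧
              ∀ e' : E, C0 < Ce e' - pa →
                ρ e' * C0 + (1 - ρ e') * Ce e' ≤ ρ e * C0 + (1 - ρ e) * Ce e) →
             σa (some e) = 0))) := by
  have hnonvul (e : E) (h : ¬ C0 < Ce e - pa) : atkPayoff C0 Ce pa ρ (some e) < C0 :=
    atkPayoff_some_lt_of_not_vulnerable hpa hρ <|
      lt_of_le_of_ne (not_lt.1 h) fun h' => hgen e (by linarith)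
  refine ⟨fun hsafe σa => ?_, fun ⟨e₀, hv₀, hlt₀⟩ σa => ?_⟩
  · have hmax : ∀ a, atkPayoff C0 Ce pa ρ a ≤ atkPayoff C0 Ce pa ρ none
      | none => le_rfl
      | some e => by
        by_cases hv : C0 < Ce e - pa
        · exact not_lt.1 fun h =>
            (hsafe e hv).not_gt ((lt_atkPayoff_some_iff ρ hpa hv).1 h)
        · exact (hnonvul e hv).le
    have hsub (e : E) : atkPayoff C0 Ce pa ρ (some e) < C0 ↔
        ¬ (C0 < Ce e - pa ∧ ρ e = rhoHat C0 Ce pa e) := by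
      by_cases hv : C0 < Ce e - pa
      · rw [atkPayoff_some_lt_iff ρ hpa hv, (hsafe e hv).lt_iff_ne]
        simp [hv, eq_comm]
      · simp [hv, hnonvul e hv]
    rw [isAtkBR_iff C0 Ce pa ρ σa hmax]
    refine and_congr_right fun _ => ?_
    simp only [Option.forall, lt_self_iff_false, false_imp_iff, true_and]
    exact forall_congr' fun e => imp_congr_left (hsub e)
  · obtain ⟨m, hm⟩ := Finite.exists_max fun e => atkPayoff C0 Ce pa ρ (some e)
    have hlt : C0 < atkPayoff C0 Ce pa ρ (some m) :=
      ((lt_atkPayoff_some_iff ρ hpa hv₀).2 hlt₀).trans_le (hm e₀)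
    have hvm : C0 < Ce m - pa := by
      by_contra h
      exact hlt.not_gt (hnonvul m h)
    have hmax : ∀ a, atkPayoff C0 Ce pa ρ a ≤ atkPayoff C0 Ce pa ρ (some m)
      | none => hlt.le
      | some e => hm e
    have hsub (e : E) : atkPayoff C0 Ce pa ρ (some e) < atkPayoff C0 Ce pa ρ (some m) ↔
        ¬ (C0 < Ce e - pa ∧ ∀ e' : E, C0 < Ce e' - pa →
          ρ e' * C0 + (1 - ρ e') * Ce e' ≤ ρ e * C0 + (1 - ρ e) * Ce e) := by
      rw [← not_le, not_iff_not]
      refine ⟨fun h => ⟨?_, fun e' _ => ?_⟩, fun h => ?_⟩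
      · by_contra hv
        exact (hlt.trans_le h).not_gt (hnonvul e hv)
      · simpa only [atkPayoff, sub_le_sub_iff_right] using (hm e').trans h
      · simpa only [atkPayoff, sub_le_sub_iff_right] using h.2 m hvm
    rw [isAtkBR_iff C0 Ce pa ρ σa hmax]
    refine and_congr_right fun _ => ?_
    rw [Option.forall]
    exact and_congr (imp_iff_right hlt) (forall_congr' fun e => imp_congr_left (hsub e))

end SecGame
end
end

section
/- Assume pa ≠ C_e − C0 for every e ∈ E. In every SPE (ρ*, σa*(·)) of the sequential game Γ̃: (i) if ρ*_e ≥ ρ̂_e for every vulnerable e ∈ V then ∑_{e∈E} σa*(e, ρ*) = 0, and otherwise ∑_{e∈E} σa*(e, ρ*) = 1; (ii) ρ*_e ≤ ρ̂_e for every e ∈ V, and ρ*_e = 0 for every e ∈ E ∖ V. -/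
open Finset

noncomputable section

namespace SecGame

variable {E : Type*} [Fintype E] [DecidableEq E]

/-- Net gain of attacking `e`, relative to not attacking, against the effort vector `ρ`. -/
def attackGain {ι : Type*} (C0 : ℝ) (Ce : ι → ℝ) (pa : ℝ) (ρ : ι → ℝ) (e : ι) : ℝ :=
  (Ce e - C0) * (1 - ρ e) - pa

/-- The least effort making an attack on `e` unprofitable. -/
def deterrence {ι : Type*} (C0 : ℝ) (Ce : ι → ℝ) (pa : ℝ) (e : ι) : ℝ :=
  if C0 < Ce e - pa then rhoHat C0 Ce pa e else 0

section Strategies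

variable {ι : Type*} [Fintype ι]

theorem IsAtkMixed.none_eq {σ : Option ι → ℝ} (h : IsAtkMixed σ) :
    σ none = 1 - ∑ e, σ (some e) := by
  have := h.2
  rw [Fintype.sum_option] at this
  linarith

theorem IsAtkMixed.sum_nonneg {σ : Option ι → ℝ} (h : IsAtkMixed σ) :
    0 ≤ ∑ e, σ (some e) :=
  Finset.sum_nonneg fun e _ => h.1 (some e)

theorem IsAtkMixed.sum_le_one {σ : Option ι → ℝ} (h : IsAtkMixed σ) :
    ∑ e, σ (some e) ≤ 1 := by
  linarith [h.none_eq, h.1 none]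

theorem isAtkMixed_single [DecidableEq ι] (a : Option ι) : IsAtkMixed (Pi.single a 1) := by
  refine ⟨fun b => ?_, by simp⟩
  by_cases h : b = a
  · subst h; simp
  · simp [h]

theorem IsAtkMixed.UaRho_eq {σ : Option ι → ℝ} (h : IsAtkMixed σ)
    (C0 : ℝ) (Ce : ι → ℝ) (pa : ℝ) (ρ : ι → ℝ) :
    UaRho C0 Ce pa ρ σ = C0 + ∑ e, σ (some e) * attackGain C0 Ce pa ρ e := by
  have key : ∑ e, σ (some e) * attackGain C0 Ce pa ρ e =
      ∑ e, (ρ e * (C0 - Ce e) * σ (some e) + Ce e * σ (some e))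
        - C0 * ∑ e, σ (some e) - pa * ∑ e, σ (some e) := by
    rw [Finset.mul_sum, Finset.mul_sum, ← Finset.sum_sub_distrib, ← Finset.sum_sub_distrib]
    refine Finset.sum_congr rfl fun e _ => ?_
    unfold attackGain
    ring
  rw [UaRho, h.none_eq, key]
  ring

theorem IsAtkMixed.UdRho_eq {σ : Option ι → ℝ} (h : IsAtkMixed σ)
    (C0 : ℝ) (Ce : ι → ℝ) (pa pd : ℝ) (ρ : ι → ℝ) :
    UdRho C0 Ce pd ρ σ = -(C0 + ∑ e, σ (some e) * attackGain C0 Ce pa ρ e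
      + pa * ∑ e, σ (some e) + pd * ∑ e, ρ e) := by
  have key : ∑ e, (ρ e * ((C0 - Ce e) * σ (some e) + pd) + Ce e * σ (some e)) =
      ∑ e, σ (some e) * attackGain C0 Ce pa ρ e
        + C0 * ∑ e, σ (some e) + pa * ∑ e, σ (some e) + pd * ∑ e, ρ e := by
    rw [Finset.mul_sum, Finset.mul_sum, Finset.mul_sum, ← Finset.sum_add_distrib,
      ← Finset.sum_add_distrib, ← Finset.sum_add_distrib]
    refine Finset.sum_congr rfl fun e _ => ?_
    unfold attackGain
    ring
  rw [UdRho, h.none_eq, key]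
  ring

end Strategies

/-- `σ` maximizes the attacker's expected gain `∑ σ(e) g(e)` over mixed strategies. -/
def IsBestResponse {ι : Type*} [Fintype ι] (g : ι → ℝ) (σ : Option ι → ℝ) : Prop :=
  IsAtkMixed σ ∧ ∀ τ, IsAtkMixed τ → ∑ e, τ (some e) * g e ≤ ∑ e, σ (some e) * g e

namespace IsBestResponse

variable {ι : Type*} [Fintype ι] {g : ι → ℝ} {σ : Option ι → ℝ}

theorem value_nonneg (h : IsBestResponse g σ) : 0 ≤ ∑ e, σ (some e) * g e := by
  classical
  simpa using h.2 _ (isAtkMixed_single none)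

theorem le_value (h : IsBestResponse g σ) (e : ι) : g e ≤ ∑ e, σ (some e) * g e := by
  classical
  simpa [Pi.single_apply] using h.2 _ (isAtkMixed_single (some e))

theorem value_le (h : IsBestResponse g σ) {B : ℝ} (hB : 0 ≤ B) (hg : ∀ e, g e ≤ B) :
    ∑ e, σ (some e) * g e ≤ B :=
  calc ∑ e, σ (some e) * g e ≤ ∑ e, σ (some e) * B :=
        Finset.sum_le_sum fun e _ => mul_le_mul_of_nonneg_left (hg e) (h.1.1 _)
    _ = (∑ e, σ (some e)) * B := (Finset.sum_mul ..).symm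
    _ ≤ B := mul_le_of_le_one_left hB h.1.sum_le_one

theorem value_eq_zero (h : IsBestResponse g σ) (hg : ∀ e, g e ≤ 0) :
    ∑ e, σ (some e) * g e = 0 :=
  le_antisymm (h.value_le le_rfl hg) h.value_nonneg

theorem sum_eq_one (h : IsBestResponse g σ) {e : ι} (he : 0 < g e) :
    ∑ e, σ (some e) = 1 := by
  have hpos : 0 < ∑ e, σ (some e) * g e := he.trans_le (h.le_value e)
  have hle : ∑ e, σ (some e) * g e ≤ (∑ e, σ (some e)) * ∑ e, σ (some e) * g e := by
    conv_rhs => rw [Finset.sum_mul]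
    exact Finset.sum_le_sum fun e _ => mul_le_mul_of_nonneg_left (h.le_value e) (h.1.1 _)
  exact le_antisymm h.1.sum_le_one ((le_mul_iff_one_le_left hpos).1 hle)

theorem sum_eq_zero (h : IsBestResponse g σ) (hg : ∀ e, g e < 0) :
    ∑ e, σ (some e) = 0 := by
  have hv := h.value_eq_zero fun e => (hg e).le
  rw [Finset.sum_eq_zero_iff_of_nonpos
    fun e _ => mul_nonpos_of_nonneg_of_nonpos (h.1.1 _) (hg e).le] at hv
  exact Finset.sum_eq_zero fun e he => (mul_eq_zero.1 (hv e he)).resolve_right (hg e).ne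

end IsBestResponse

section Deterrence

variable {ι : Type*} {C0 pa : ℝ} {Ce : ι → ℝ}

theorem deterrence_nonneg (hpa : 0 < pa) (e : ι) : 0 ≤ deterrence C0 Ce pa e := by
  unfold deterrence rhoHat
  split_ifs with h
  · exact div_nonneg (by linarith) (by linarith)
  · exact le_rfl

theorem deterrence_lt_one (hpa : 0 < pa) (e : ι) : deterrence C0 Ce pa e < 1 := by
  unfold deterrence rhoHat
  split_ifs with h
  · rw [div_lt_one (by linarith)]
    linarith
  · exact one_pos

theorem attackGain_eq_of_vulnerable (hpa : 0 < pa) (ρ : ι → ℝ) {e : ι} (he : C0 < Ce e - pa) :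
    attackGain C0 Ce pa ρ e = (Ce e - C0) * (rhoHat C0 Ce pa e - ρ e) := by
  have : Ce e - C0 ≠ 0 := by linarith
  unfold attackGain rhoHat
  field_simp
  ring

theorem attackGain_neg_of_not_vulnerable (hpa : 0 < pa) {ρ : ι → ℝ} (hρ : InBox ρ) {e : ι}
    (hgen : pa ≠ Ce e - C0) (he : ¬ C0 < Ce e - pa) : attackGain C0 Ce pa ρ e < 0 := by
  have hlt : Ce e - C0 < pa := lt_of_le_of_ne (by linarith) hgen.symm
  obtain ⟨h0, h1⟩ := hρ e
  unfold attackGain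
  rcases le_total 0 (Ce e - C0) with h | h <;> nlinarith

theorem attackGain_nonpos (hpa : 0 < pa) {ρ : ι → ℝ} (hρ : InBox ρ) {e : ι}
    (hgen : pa ≠ Ce e - C0) (h : deterrence C0 Ce pa e ≤ ρ e) :
    attackGain C0 Ce pa ρ e ≤ 0 := by
  by_cases he : C0 < Ce e - pa
  · rw [attackGain_eq_of_vulnerable hpa ρ he]
    rw [deterrence, if_pos he] at h
    exact mul_nonpos_of_nonneg_of_nonpos (by linarith) (by linarith)
  · exact (attackGain_neg_of_not_vulnerable hpa hρ hgen he).le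

theorem attackGain_neg (hpa : 0 < pa) {ρ : ι → ℝ} (hρ : InBox ρ) {e : ι}
    (hgen : pa ≠ Ce e - C0) (h : deterrence C0 Ce pa e < ρ e) :
    attackGain C0 Ce pa ρ e < 0 := by
  by_cases he : C0 < Ce e - pa
  · rw [attackGain_eq_of_vulnerable hpa ρ he]
    rw [deterrence, if_pos he] at h
    exact mul_neg_of_pos_of_neg (by linarith) (by linarith)
  · exact attackGain_neg_of_not_vulnerable hpa hρ hgen he

end Deterrence

section Equilibrium

variable {ι : Type*} [Fintype ι] {C0 pa pd : ℝ} {Ce ρstar : ι → ℝ} {σastar : (ι → ℝ) → Option ι → ℝ}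

theorem IsSPE.isBestResponse (h : IsSPE C0 Ce pa pd ρstar σastar) {ρ : ι → ℝ} (hρ : InBox ρ) :
    IsBestResponse (attackGain C0 Ce pa ρ) (σastar ρ) := by
  obtain ⟨hm, hbest⟩ := h.2.1 ρ hρ
  refine ⟨hm, fun τ hτ => ?_⟩
  have := hbest τ hτ
  rw [hτ.UaRho_eq, hm.UaRho_eq] at this
  linarith

theorem IsSPE.loss_le (h : IsSPE C0 Ce pa pd ρstar σastar) {ρ : ι → ℝ} (hρ : InBox ρ) :
    ∑ e, σastar ρstar (some e) * attackGain C0 Ce pa ρstar e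
        + pa * ∑ e, σastar ρstar (some e) + pd * ∑ e, ρstar e ≤
      ∑ e, σastar ρ (some e) * attackGain C0 Ce pa ρ e
        + pa * ∑ e, σastar ρ (some e) + pd * ∑ e, ρ e := by
  have := h.2.2 ρ hρ
  rw [(h.2.1 ρ hρ).1.UdRho_eq C0 Ce pa, (h.2.1 ρstar h.1).1.UdRho_eq C0 Ce pa] at this
  linarith

/-- An equilibrium effort vector deterring all attacks costs the defender no more than the
deterrence thresholds, because it can be compared with slightly more than the thresholds. -/
theorem IsSPE.loss_le_deterrence (h : IsSPE C0 Ce pa pd ρstar σastar) (hpa : 0 < pa)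
    (hpd : 0 < pd) (hgen : ∀ e, pa ≠ Ce e - C0)
    (hdet : ∀ e, deterrence C0 Ce pa e ≤ ρstar e) :
    pa * ∑ e, σastar ρstar (some e) + pd * ∑ e, (ρstar e - deterrence C0 Ce pa e) ≤ 0 := by
  set t := deterrence C0 Ce pa with ht
  set X := pa * ∑ e, σastar ρstar (some e) + pd * ∑ e, (ρstar e - t e) with hX
  set K := pd * ∑ e, (1 - t e) with hK
  have ht0 : ∀ e, 0 ≤ t e := deterrence_nonneg hpa
  have ht1 : ∀ e, t e < 1 := deterrence_lt_one hpa
  have hK0 : 0 ≤ K := mul_nonneg hpd.le (Finset.sum_nonneg fun e _ => by linarith [ht1 e])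
  have hbound : ∀ ε : ℝ, 0 < ε → ε ≤ 1 → X ≤ ε * K := by
    intro ε hε hε1
    have hbox : InBox fun e => t e + ε * (1 - t e) := fun e =>
      ⟨by nlinarith [ht0 e, ht1 e], by nlinarith [ht0 e, ht1 e]⟩
    have hneg : ∀ e, attackGain C0 Ce pa (fun e => t e + ε * (1 - t e)) e < 0 := fun e =>
      attackGain_neg hpa hbox (hgen e) (by nlinarith [mul_pos hε (sub_pos.2 (ht1 e))])
    have hloss := h.loss_le hbox
    rw [(h.isBestResponse hbox).sum_eq_zero hneg,
      (h.isBestResponse hbox).value_eq_zero fun e => (hneg e).le,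
      (h.isBestResponse h.1).value_eq_zero
        fun e => attackGain_nonpos hpa h.1 (hgen e) (hdet e),
      Finset.sum_add_distrib, ← Finset.mul_sum] at hloss
    rw [hX, hK, Finset.sum_sub_distrib]
    linarith
  by_contra! hpos
  have hb := hbound (X / (X + K)) (by positivity) ((div_le_one (by positivity)).2 (by linarith))
  rw [div_mul_eq_mul_div, le_div_iff₀ (by positivity)] at hb
  nlinarith

theorem IsSPE.le_deterrence_of_attackGain_pos (h : IsSPE C0 Ce pa pd ρstar σastar)
    (hpa : 0 < pa) (hpd : 0 < pd) (hgen : ∀ e, pa ≠ Ce e - C0)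
    {f : ι} (hf : 0 < attackGain C0 Ce pa ρstar f) (e : ι) :
    ρstar e ≤ deterrence C0 Ce pa e := by
  classical
  by_contra! hlt
  set ρ := Function.update ρstar e (deterrence C0 Ce pa e) with hρ
  have hρe : ρ e = deterrence C0 Ce pa e := Function.update_self ..
  have hρne : ∀ e', e' ≠ e → ρ e' = ρstar e' := fun e' he' => Function.update_of_ne he' ..
  have hgain : ∀ e', e' ≠ e → attackGain C0 Ce pa ρ e' = attackGain C0 Ce pa ρstar e' :=
    fun e' he' => by rw [attackGain, hρne e' he', attackGain]
  have hbox : InBox ρ := fun e' => by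
    by_cases he' : e' = e
    · rw [he', hρe]
      exact ⟨deterrence_nonneg hpa e, (deterrence_lt_one hpa e).le⟩
    · rw [hρne e' he']
      exact h.1 e'
  have hfe : f ≠ e := by
    rintro rfl
    exact (attackGain_neg hpa h.1 (hgen f) hlt).not_gt hf
  have hbr := h.isBestResponse h.1
  have hbr' := h.isBestResponse hbox
  have hvalue := hbr'.value_le hbr.value_nonneg fun e' => by
    by_cases he' : e' = e
    · rw [he']
      exact (attackGain_nonpos hpa hbox (hgen e) hρe.ge).trans hbr.value_nonneg
    · rw [hgain e' he']
      exact hbr.le_value e'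
  have hsum : ∑ e', ρ e' < ∑ e', ρstar e' := by
    refine Finset.sum_lt_sum (fun e' _ => ?_) ⟨e, Finset.mem_univ e, hρe ▸ hlt⟩
    by_cases he' : e' = e
    · rw [he', hρe]
      exact hlt.le
    · exact (hρne e' he').le
  have hloss := h.loss_le hbox
  rw [hbr.sum_eq_one hf, hbr'.sum_eq_one (hgain f hfe ▸ hf)] at hloss
  nlinarith [mul_lt_mul_of_pos_left hsum hpd]

end Equilibrium

/-- **Lemma 5 (structure of SPE).**
Assume `pa ≠ C_e − C0` for every `e`. In every SPE `(ρ*, σa*(·))` of the sequential game Γ̃: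
(i) if `ρ*_e ≥ ρ̂_e` for every vulnerable facility then the total on-path attack probability
is `0`, and otherwise it is `1`; (ii) `ρ*_e ≤ ρ̂_e` for every vulnerable `e`, and `ρ*_e = 0`
for every non-vulnerable `e`. -/
theorem SPE_attack_zero_or_one {E : Type*} [Fintype E] [DecidableEq E] [Nonempty E]
    (C0 : ℝ) (Ce : E → ℝ) (pa pd : ℝ) (hpa : 0 < pa) (hpd : 0 < pd)
    (hgen : ∀ e : E, pa ≠ Ce e - C0)
    (ρstar : E → ℝ) (σastar : (E → ℝ) → Option E → ℝ)
    (hSPE : IsSPE C0 Ce pa pd ρstar σastar) :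
    ((∀ e : E, C0 < Ce e - pa → rhoHat C0 Ce pa e ≤ ρstar e) →
       ∑ e : E, σastar ρstar (some e) = 0) ∧
    (¬ (∀ e : E, C0 < Ce e - pa → rhoHat C0 Ce pa e ≤ ρstar e) →
       ∑ e : E, σastar ρstar (some e) = 1) ∧
    (∀ e : E, C0 < Ce e - pa → ρstar e ≤ rhoHat C0 Ce pa e) ∧
    (∀ e : E, ¬ C0 < Ce e - pa → ρstar e = 0) := by
  have hbr := hSPE.isBestResponse hSPE.1
  have hpass : ∀ e : E, C0 < Ce e - pa → deterrence C0 Ce pa e = rhoHat C0 Ce pa e :=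
    fun e he => if_pos he
  have hzero : ∀ e : E, ¬ C0 < Ce e - pa → deterrence C0 Ce pa e = 0 := fun e he => if_neg he
  suffices hmain : ((∀ e : E, C0 < Ce e - pa → rhoHat C0 Ce pa e ≤ ρstar e) →
       ∑ e : E, σastar ρstar (some e) = 0) ∧
      (¬ (∀ e : E, C0 < Ce e - pa → rhoHat C0 Ce pa e ≤ ρstar e) →
       ∑ e : E, σastar ρstar (some e) = 1) ∧
      ∀ e : E, ρstar e ≤ deterrence C0 Ce pa e from
    ⟨hmain.1, hmain.2.1, fun e he => hpass e he ▸ hmain.2.2 e,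
      fun e he => le_antisymm (hzero e he ▸ hmain.2.2 e) (hSPE.1 e).1⟩
  by_cases hall : ∀ e : E, C0 < Ce e - pa → rhoHat C0 Ce pa e ≤ ρstar e
  · have hdet : ∀ e, deterrence C0 Ce pa e ≤ ρstar e := fun e => by
      by_cases he : C0 < Ce e - pa
      · exact hpass e he ▸ hall e he
      · exact hzero e he ▸ (hSPE.1 e).1
    have hle := hSPE.loss_le_deterrence hpa hpd hgen hdet
    have hattack := hbr.1.sum_nonneg
    have hexcess : 0 ≤ ∑ e, (ρstar e - deterrence C0 Ce pa e) :=
      Finset.sum_nonneg fun e _ => sub_nonneg.2 (hdet e)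
    refine ⟨fun _ => by nlinarith [mul_nonneg hpd.le hexcess],
      fun hnot => absurd hall hnot, fun e => ?_⟩
    have hterm := Finset.single_le_sum (f := fun e => ρstar e - deterrence C0 Ce pa e)
      (fun e _ => sub_nonneg.2 (hdet e)) (Finset.mem_univ e)
    have : ∑ e, (ρstar e - deterrence C0 Ce pa e) ≤ 0 := by
      nlinarith [mul_nonneg hpa.le hattack]
    linarith
  · refine ⟨fun hyes => absurd hyes hall, fun _ => ?_, ?_⟩ <;> push Not at hall <;>
      obtain ⟨f, hf, hlt⟩ := hall
    all_goals
      have hgain : 0 < attackGain C0 Ce pa ρstar f := by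
        rw [attackGain_eq_of_vulnerable hpa ρstar hf]
        exact mul_pos (by linarith) (by linarith)
    · exact hbr.sum_eq_one hgain
    · exact hSPE.le_deterrence_of_attackGain_pos hpa hpd hgen hgain


end SecGame
end
end
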